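/- arXiv:1701.08115 — 4 statements merged into one kernel-verified Lean document; each statement's English description precedes it below -/
import Mathlib

section
/- Let k ≥ 3 and s ≥ 2k² be integers with s not divisible by k. Then there exist a graph G_s on [k] that is a disjoint union of paths, and positive integers a_{s,1},…,a_{s,k} and ℓ, such that: |a_{s,i} − a_{s,j}| ≤ 1 for all 1 ≤ i, j ≤ k; ℓ = |E(G_s)| ≤ k − 1; and, setting K = K^k(a_{s,1},…,a_{s,k}), the k-graph F_s = F(K, G_s) satisfies |V(F_s) ∖ V(K)| = ℓ and contains a spanning copy of the tight cycle C_s^k (in particular ℓ + a_{s,1} + ⋯ + a_{s,k} = s). -/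
set_option autoImplicit false

open Finset

section Defs

variable {V : Type} [Fintype V] [DecidableEq V]

/-- `E` is the edge set of a `k`-uniform hypergraph on `V`. -/
def IsKGraph (k : ℕ) (E : Finset (Finset V)) : Prop := ∀ e ∈ E, e.card = k

/-- The degree of a vertex set `S`: the number of edges containing `S`. -/
def degS (E : Finset (Finset V)) (S : Finset V) : ℕ := (E.filter fun e => S ⊆ e).card

/-- `C` is the (cyclically ordered) vertex list of a copy of a tight cycle:
the vertices are distinct and every `k` cyclically consecutive vertices form an edge. -/
def IsTightCycleList (k : ℕ) (E : Finset (Finset V)) (C : List V) : Prop :=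
  C.Nodup ∧ ∀ i < C.length, (((C ++ C).drop i).take k).toFinset ∈ E

/-- `H` has a `C_s^k`-covering: every vertex lies in a copy of the tight cycle on `s` vertices. -/
def HasCsCovering (k s : ℕ) (E : Finset (Finset V)) : Prop :=
  ∀ v : V, ∃ C : List V, C.length = s ∧ IsTightCycleList k E C ∧ v ∈ C

/-- `H` contains a copy of `C_s^k`. -/
def HasCsCopy (k s : ℕ) (E : Finset (Finset V)) : Prop :=
  ∃ C : List V, C.length = s ∧ IsTightCycleList k E C

/-- `A` is the vertex set of a copy of `C_s^k` in `H`. -/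
def SpansCs (k s : ℕ) (E : Finset (Finset V)) (A : Finset V) : Prop :=
  ∃ C : List V, C.length = s ∧ IsTightCycleList k E C ∧ C.toFinset = A

/-- a `C_s^k`-tiling: a set of pairwise disjoint vertex sets of copies of `C_s^k`. -/
def IsCsTiling (k s : ℕ) (E : Finset (Finset V)) (T : Finset (Finset V)) : Prop :=
  (T : Set (Finset V)).PairwiseDisjoint id ∧ ∀ A ∈ T, SpansCs k s E A

/-- a perfect `C_s^k`-tiling of the induced subgraph on `U`. -/
def HasPerfectCsTilingOn (k s : ℕ) (E : Finset (Finset V)) (U : Finset V) : Prop :=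
  ∃ T : Finset (Finset V), IsCsTiling k s E T ∧ T.biUnion id = U

/-- a perfect `C_s^k`-tiling of `H`. -/
def HasPerfectCsTiling (k s : ℕ) (E : Finset (Finset V)) : Prop :=
  HasPerfectCsTilingOn k s E Finset.univ

/-- the pair `(k,s)` is admissible if `gcd k s = 1` or `k / gcd k s` is even. -/
def AdmissiblePair (k s : ℕ) : Prop := Nat.gcd k s = 1 ∨ Even (k / Nat.gcd k s)

/-- The `k`-graph `H₀^k(A,B)`: edges are the `k`-subsets `e` of `A ∪ B`
with `|e ∩ A| ≢ k (mod 2)`. -/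
def H0edges (k : ℕ) (A B : Finset V) : Finset (Finset V) :=
  ((A ∪ B).powersetCard k).filter fun e => ¬ (e ∩ A).card % 2 = k % 2

/-- `P` is (the vertex list of) a tight path: distinct vertices, every `k`
consecutive vertices form an edge. -/
def IsTightPath (k : ℕ) (E : Finset (Finset V)) (P : List V) : Prop :=
  P.Nodup ∧ ∀ i, i + k ≤ P.length → ((P.drop i).take k).toFinset ∈ E

/-- `P = v₁ ⋯ v_ℓ` has start of type `σ` w.r.t. classes `Vc`: `v_i ∈ V_{σ(i)}`
for `1 ≤ i ≤ k-1` (0-indexed below). -/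
def hasStartType (k : ℕ) (Vc : Fin k → Finset V) (P : List V) (σ : Equiv.Perm (Fin k)) : Prop :=
  k ≤ P.length + 1 ∧ ∀ j : Fin k, (j : ℕ) + 1 < k → ∀ v ∈ P[(j : ℕ)]?, v ∈ Vc (σ j)

/-- `P = v₁ ⋯ v_ℓ` has end of type `σ` w.r.t. classes `Vc`: `v_{ℓ-k+i} ∈ V_{σ(i)}`
for `2 ≤ i ≤ k` (0-indexed below). -/
def hasEndType (k : ℕ) (Vc : Fin k → Finset V) (P : List V) (σ : Equiv.Perm (Fin k)) : Prop :=
  k ≤ P.length + 1 ∧ ∀ j : Fin k, (j : ℕ) ≠ 0 →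
    ∀ v ∈ P[(P.length + (j : ℕ) - k)]?, v ∈ Vc (σ j)

/-- `Vc` are the classes of a complete `(k,k)`-graph in `H`: nonempty, pairwise disjoint,
and every transversal is an edge. -/
def IsCompletePartite (k : ℕ) (E : Finset (Finset V)) (Vc : Fin k → Finset V) : Prop :=
  (∀ i, (Vc i).Nonempty) ∧ (∀ i j, i ≠ j → Disjoint (Vc i) (Vc j)) ∧
  ∀ g : Fin k → V, (∀ i, g i ∈ Vc i) → Finset.image g Finset.univ ∈ E

/-- the cyclic permutation `τ = (1 2 ⋯ k)` (0-indexed: `j ↦ j + 1 mod k`). -/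
def cyc (k : ℕ) : Equiv.Perm (Fin k) := finRotate k

/-- `W` is a `G`-gadget for the complete `(k,k)`-graph with classes `Vc` avoiding `S`. -/
def IsGadget (k : ℕ) (E : Finset (Finset V)) (Vc : Fin k → Finset V)
    (G : SimpleGraph (Fin k)) (S : Finset V) (W : Fin k → Fin k → Finset V) : Prop :=
  (∀ i j, G.Adj i j → W i j = W j i) ∧
  (∀ i j, G.Adj i j →
    (W i j).card = 2 * k - 1 ∧
    (W i j \ Finset.univ.biUnion Vc).card = 1 ∧
    Disjoint (W i j) S ∧
    (∀ i' : Fin k, (W i j ∩ Vc i').card = if i' = i ∨ i' = j then 1 else 2) ∧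
    (∀ σ : Equiv.Perm (Fin k), (∃ z : Fin k, (z : ℕ) = 0 ∧ (σ z = i ∨ σ z = j)) →
      ∃ Q : List V, IsTightPath k E Q ∧ Q.toFinset = W i j ∧
        hasStartType k Vc Q (σ * cyc k) ∧ hasEndType k Vc Q (Equiv.swap i j * σ))) ∧
  (∀ i j i' j', G.Adj i j → G.Adj i' j' → ({i, j} : Finset (Fin k)) ≠ {i', j'} →
    Disjoint (W i j) (W i' j'))

open Classical in
/-- the set of vertices `w_{ij}`, `ij ∈ E(G)`, of a gadget `W`. -/
noncomputable def gadgetVerts (k : ℕ) (Vc : Fin k → Finset V)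
    (G : SimpleGraph (Fin k)) (W : Fin k → Fin k → Finset V) : Finset V :=
  (Finset.univ.filter fun p : Fin k × Fin k => G.Adj p.1 p.2).biUnion
    fun p => W p.1 p.2 \ Finset.univ.biUnion Vc

/-- the graph on `[k]` consisting of the paths given by the lists in `L`. -/
def pathsGraph (k : ℕ) (L : List (List (Fin k))) : SimpleGraph (Fin k) :=
  SimpleGraph.fromEdgeSet {e | ∃ l ∈ L, ∃ p ∈ l.zip l.tail, e = s(p.1, p.2)}

/-- `G` is a vertex-disjoint union of paths. -/
def IsUnionOfPaths (k : ℕ) (G : SimpleGraph (Fin k)) : Prop :=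
  ∃ L : List (List (Fin k)), (∀ l ∈ L, l.Nodup) ∧
    L.Pairwise (fun l₁ l₂ => ∀ a ∈ l₁, ∀ b ∈ l₂, a ≠ b) ∧ G = pathsGraph k L

/-- `m(σ)` (1-indexed), read off from the normalized cycle decomposition `L` of `σ`:
the last element of the last cycle, or `1` if `L` is empty. -/
def mOf (k : ℕ) (L : List (List (Fin k))) : ℕ :=
  ((L.getLast?.bind List.getLast?).map (fun x => (x : ℕ) + 1)).getD 1

/-- `L` is the normalized cycle decomposition of `σ`: disjoint cycles of length ≥ 2,
each cycle listed ending with its minimal element, the cycles ordered by increasing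
last elements. -/
def IsNormCycleDecomp (k : ℕ) (σ : Equiv.Perm (Fin k)) (L : List (List (Fin k))) : Prop :=
  (∀ l ∈ L, 2 ≤ l.length ∧ l.Nodup) ∧
  L.Pairwise (fun l₁ l₂ => ∀ a ∈ l₁, ∀ b ∈ l₂, a ≠ b) ∧
  σ = (L.map List.formPerm).prod ∧
  (∀ l ∈ L, ∀ a ∈ l.getLast?, ∀ b ∈ l, a ≤ b) ∧
  L.Pairwise (fun l₁ l₂ => ∀ a ∈ l₁.getLast?, ∀ b ∈ l₂.getLast?, a < b)

/-- `H` is `(μ, θ)`-dense. -/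
def IsDense (k : ℕ) (μ θ : ℝ) (E : Finset (Finset V)) : Prop :=
  ∃ 𝒮 : Finset (Finset V), (∀ S ∈ 𝒮, S.card = k - 1) ∧
    (𝒮.card : ℝ) ≤ θ * ((Fintype.card V).choose (k - 1)) ∧
    ∀ S : Finset V, S.card = k - 1 → S ∉ 𝒮 →
      μ * ((Fintype.card V : ℝ) - k + 1) ≤ (degS E S : ℝ)

/-- `H` is strongly `(μ, θ)`-dense. -/
def IsStronglyDense (k : ℕ) (μ θ : ℝ) (E : Finset (Finset V)) : Prop :=
  IsDense k μ θ E ∧ ∀ e ∈ E, ∀ X ⊆ e, X.card = k - 1 →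
    μ * ((Fintype.card V : ℝ) - k + 1) ≤ (degS E X : ℝ)

/-- the vertex set of `F(K,G)` inside the ambient type: all core vertices, plus one
pendant vertex for each edge of `G`. -/
def FsVertexSet (k : ℕ) (a : Fin k → ℕ) (G : SimpleGraph (Fin k)) :
    Set ((Σ i : Fin k, Fin (a i)) ⊕ Sym2 (Fin k)) :=
  Set.range Sum.inl ∪ Sum.inr '' G.edgeSet

/-- the edges of `F(K,G)`, where `K = K^k(a)`: all transversals of the classes, plus,
for each edge `ij` of `G`, all `k`-sets consisting of the pendant vertex `w_{ij}` and one
vertex from each class other than `i` (resp. other than `j`). -/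
def FKGedges (k : ℕ) (a : Fin k → ℕ) (G : SimpleGraph (Fin k)) :
    Set (Finset ((Σ i : Fin k, Fin (a i)) ⊕ Sym2 (Fin k))) :=
  {e | (∃ g : ∀ i, Fin (a i), e = Finset.univ.image fun i => Sum.inl ⟨i, g i⟩) ∨
    (∃ i j, G.Adj i j ∧ ∃ g : ∀ i', Fin (a i'),
      e = insert (Sum.inr s(i, j)) ((Finset.univ.erase i).image fun i' => Sum.inl ⟨i', g i'⟩))}

/-- `F(K^k(a), G)` contains a spanning copy of the tight cycle `C_s^k`. -/
def FsHasSpanningCs (k s : ℕ) (a : Fin k → ℕ) (G : SimpleGraph (Fin k)) : Prop :=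
  ∃ C : List ((Σ i : Fin k, Fin (a i)) ⊕ Sym2 (Fin k)),
    C.Nodup ∧ C.length = s ∧ (↑C.toFinset : Set _) = FsVertexSet k a G ∧
    ∀ i < C.length, (((C ++ C).drop i).take k).toFinset ∈ FKGedges k a G

/-- `A` is the vertex set of a copy of `K^k(t)` in `H`. -/
def SpansEsCopy (k t : ℕ) (E : Finset (Finset V)) (A : Finset V) : Prop :=
  ∃ f : Fin k × Fin t → V, Function.Injective f ∧ Finset.univ.image f = A ∧
    ∀ g : Fin k → Fin t, (Finset.univ.image fun i => f (i, g i)) ∈ E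

/-- `A` is the vertex set of a copy of `F_s = F(K^k(a), G)` in `H`. -/
def SpansFsCopy (k : ℕ) (a : Fin k → ℕ) (G : SimpleGraph (Fin k))
    (E : Finset (Finset V)) (A : Finset V) : Prop :=
  ∃ f : ((Σ i : Fin k, Fin (a i)) ⊕ Sym2 (Fin k)) → V,
    Set.InjOn f (FsVertexSet k a G) ∧ f '' FsVertexSet k a G = ↑A ∧
    ∀ e ∈ FKGedges k a G, e.image f ∈ E

/-- `(TF, TE)` is an `{F_s, E_s}`-tiling of `H`, given as the families of vertex sets of
the copies of `F_s` and of `E_s = K^k(max_i a_i)`. -/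
def IsFETiling (k : ℕ) (a : Fin k → ℕ) (G : SimpleGraph (Fin k))
    (E : Finset (Finset V)) (TF TE : Finset (Finset V)) : Prop :=
  ((↑(TF ∪ TE) : Set (Finset V)).PairwiseDisjoint id) ∧
  (∀ A ∈ TF, SpansFsCopy k a G E A) ∧
  (∀ A ∈ TE, SpansEsCopy k (Finset.univ.sup a) E A)

/-- `φ(𝒯) = (n - s(|ℱ_𝒯| + (3/5)|ℰ_𝒯|))/n`. -/
noncomputable def phiTiling (s : ℕ) (TF TE : Finset (Finset V)) : ℝ :=
  ((Fintype.card V : ℝ) - s * ((TF.card : ℝ) + (3 / 5) * (TE.card : ℝ))) / (Fintype.card V : ℝ)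

/-- `φ(H)`: the minimum of `φ(𝒯)` over all `{F_s, E_s}`-tilings of `H`. -/
noncomputable def phiMin (k s : ℕ) (a : Fin k → ℕ) (G : SimpleGraph (Fin k))
    (E : Finset (Finset V)) : ℝ :=
  sInf {x | ∃ TF TE : Finset (Finset V), IsFETiling k a G E TF TE ∧ x = phiTiling s TF TE}

/-- `Φ(n, μ, θ)`: the maximum of `φ(H)` over all `(μ,θ)`-dense `k`-graphs `H` on `n` vertices. -/
noncomputable def PhiMax (k s : ℕ) (a : Fin k → ℕ) (G : SimpleGraph (Fin k))
    (n : ℕ) (μ θ : ℝ) : ℝ :=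
  sSup {x | ∃ E : Finset (Finset (Fin n)), IsKGraph k E ∧ IsDense k μ θ E ∧
    x = phiMin k s a G E}

end Defs

/-- The graph on `[k]` joining `x` and `x + d`. -/
def stepGraph (k d : ℕ) : SimpleGraph (Fin k) :=
  SimpleGraph.fromRel fun x y => (x : ℕ) + d = y

theorem stepGraph_adj {k d : ℕ} (hd : 0 < d) {x y : Fin k} :
    (stepGraph k d).Adj x y ↔ ((x : ℕ) + d = y ∨ (y : ℕ) + d = x) := by
  simp only [stepGraph, SimpleGraph.fromRel_adj, ne_eq, and_iff_right_iff_imp]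
  rintro h rfl
  omega

theorem mem_zip_tail_iff {α : Type*} (l : List α) (p : α × α) :
    p ∈ l.zip l.tail ↔ ∃ (i : ℕ) (h : i + 1 < l.length), p = (l[i], l[i + 1]) := by
  simp only [List.mem_iff_getElem, List.length_zip, List.length_tail, List.getElem_zip,
    List.getElem_tail]
  constructor
  · rintro ⟨i, h, rfl⟩
    exact ⟨i, by omega, rfl⟩
  · rintro ⟨i, h, rfl⟩
    exact ⟨i, by omega, rfl⟩

theorem isUnionOfPaths_stepGraph {k d : ℕ} (hd : 0 < d) (hdk : d ∣ k) :
    IsUnionOfPaths k (stepGraph k d) := by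
  obtain ⟨n, rfl⟩ := hdk
  have hlt (c : Fin d) (i : Fin n) : (c : ℕ) + d * i < d * n := by
    have : d * ((i : ℕ) + 1) ≤ d * n := Nat.mul_le_mul_left _ i.2
    have := c.2
    rw [mul_add] at *
    omega
  refine ⟨(List.finRange d).map fun c : Fin d => List.ofFn fun i : Fin n =>
    (⟨(c : ℕ) + d * i, hlt c i⟩ : Fin (d * n)), ?_, ?_, ?_⟩
  · simp only [List.mem_map, List.mem_finRange, true_and, forall_exists_index,
      forall_apply_eq_imp_iff, List.nodup_ofFn]
    intro c i j hij
    simp only [Fin.mk.injEq, Nat.add_left_cancel_iff] at hij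
    exact Fin.ext (Nat.eq_of_mul_eq_mul_left hd hij)
  · rw [List.pairwise_map]
    refine (List.nodup_finRange d).imp fun {c c'} hne => ?_
    simp only [List.mem_ofFn, forall_exists_index, forall_apply_eq_imp_iff, ne_eq, Fin.mk.injEq]
    intro i j h
    have := congrArg (· % d) h
    simp only [Nat.add_mul_mod_self_left, Nat.mod_eq_of_lt c.2, Nat.mod_eq_of_lt c'.2] at this
    exact hne (Fin.ext this)
  · ext x y
    have key (x y : Fin (d * n)) : (x : ℕ) + d = y ↔
        ∃ (c : Fin d) (i : ℕ) (h : i + 1 < n),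
          x = ⟨c + d * i, hlt c ⟨i, by omega⟩⟩ ∧ y = ⟨c + d * (i + 1), hlt c ⟨i + 1, h⟩⟩ := by
      constructor
      · intro h
        have h1 := Nat.mod_add_div (x : ℕ) d
        refine ⟨⟨x % d, Nat.mod_lt _ hd⟩, x / d, ?_, Fin.ext h1.symm, Fin.ext ?_⟩
        · have h2 : (y : ℕ) / d < n := Nat.div_lt_of_lt_mul y.2
          rwa [← h, Nat.add_div_right _ hd] at h2
        · change (y : ℕ) = x % d + d * (x / d + 1)
          rw [mul_add, ← h]
          omega
      · rintro ⟨c, i, h, rfl, rfl⟩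
        simp only [mul_add]
        omega
    rw [stepGraph_adj hd, key x y, key y x]
    simp only [pathsGraph, SimpleGraph.fromEdgeSet_adj, Set.mem_ofPred_eq, List.mem_map,
      List.mem_finRange, true_and, exists_exists_eq_and, mem_zip_tail_iff, List.length_ofFn,
      List.getElem_ofFn]
    constructor
    · rintro (⟨c, i, h, rfl, rfl⟩ | ⟨c, i, h, rfl, rfl⟩)
      · refine ⟨⟨c, _, ⟨i, h, rfl⟩, rfl⟩, ?_⟩
        simp only [ne_eq, Fin.mk.injEq, mul_add]
        omega
      · refine ⟨⟨c, _, ⟨i, h, rfl⟩, Sym2.eq_swap⟩, ?_⟩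
        simp only [ne_eq, Fin.mk.injEq, mul_add]
        omega
    · rintro ⟨⟨c, _, ⟨i, h, rfl⟩, he⟩, -⟩
      rcases Sym2.eq_iff.1 he with ⟨rfl, rfl⟩ | ⟨rfl, rfl⟩
      · exact Or.inl ⟨c, i, h, rfl, rfl⟩
      · exact Or.inr ⟨c, i, h, rfl, rfl⟩

theorem ncard_edgeSet_stepGraph_le {k d : ℕ} (hd : 0 < d) :
    (stepGraph k d).edgeSet.ncard ≤ k - d := by
  let f : Fin (k - d) → Sym2 (Fin k) := fun i => s(⟨i, by omega⟩, ⟨i + d, by omega⟩)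
  have hsub : (stepGraph k d).edgeSet ⊆ f '' Set.univ := by
    intro e
    induction e with
    | _ x y =>
      rw [SimpleGraph.mem_edgeSet, stepGraph_adj hd]
      rintro (h | h)
      · exact ⟨⟨x, by omega⟩, trivial, Sym2.eq_iff.2 (Or.inl ⟨rfl, Fin.ext h⟩)⟩
      · exact ⟨⟨y, by omega⟩, trivial, Sym2.eq_iff.2 (Or.inr ⟨rfl, Fin.ext h⟩)⟩
  calc _ ≤ (f '' Set.univ).ncard := Set.ncard_le_ncard hsub
    _ ≤ (Set.univ : Set (Fin (k - d))).ncard := Set.ncard_image_le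
    _ = k - d := by simp [Set.ncard_univ]

theorem ncard_edgeSet_stepGraph_pos {k d : ℕ} (hd : 0 < d) (hdk : d < k) :
    1 ≤ (stepGraph k d).edgeSet.ncard := by
  rw [Nat.one_le_iff_ne_zero, ← Nat.pos_iff_ne_zero, Set.ncard_pos]
  exact ⟨s(⟨0, by omega⟩, ⟨d, hdk⟩), by simp [stepGraph_adj hd]⟩

theorem ncard_edgeSet_add_sum_eq {k s : ℕ} {a : Fin k → ℕ} {G : SimpleGraph (Fin k)}
    (h : FsHasSpanningCs k s a G) : G.edgeSet.ncard + ∑ i, a i = s := by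
  obtain ⟨C, hnd, hlen, hC, -⟩ := h
  have h1 : (FsVertexSet k a G).ncard = s := by
    rw [← hC, Set.ncard_coe_finset, List.toFinset_card_of_nodup hnd, hlen]
  rw [← h1, FsVertexSet, Set.ncard_union_eq, Set.ncard_image_of_injective _ Sum.inr_injective,
    ← Set.image_univ, Set.ncard_image_of_injective _ Sum.inl_injective, Set.ncard_univ,
    Nat.card_eq_fintype_card, Fintype.card_sigma, add_comm]
  · simp
  · rw [Set.disjoint_left]
    rintro _ ⟨x, rfl⟩ ⟨y, -, hy⟩
    cases hy

/-- The number of positions below `s` at which `ty` takes the value `i`. -/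
def classCount {k : ℕ} (ty : ℕ → Fin k ⊕ Sym2 (Fin k)) (s : ℕ) (i : Fin k) : ℕ :=
  ((range s).filter fun p => ty p = Sum.inl i).card

theorem exists_labelling {k s : ℕ} (G : SimpleGraph (Fin k)) (ty : ℕ → Fin k ⊕ Sym2 (Fin k))
    (hpos : ∀ i, 1 ≤ classCount ty s i)
    (hedge : ∀ p e, ty p = Sum.inr e → e ∈ G.edgeSet)
    (hinj : ∀ p p' e, ty p = Sum.inr e → ty p' = Sum.inr e → p = p')
    (hex : ∀ e ∈ G.edgeSet, ∃ p < s, ty p = Sum.inr e) :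
    ∃ v : ℕ → (Σ i : Fin k, Fin (classCount ty s i)) ⊕ Sym2 (Fin k),
      (∀ p, (v p).map Sigma.fst id = ty p) ∧
      Set.BijOn v (Set.Iio s) (FsVertexSet k (classCount ty s) G) := by
  let S (i : Fin k) : Finset ℕ := (range s).filter fun p => ty p = Sum.inl i
  let E (i : Fin k) : S i ≃ Fin (classCount ty s i) := (S i).equivFin
  let F (i : Fin k) (p : ℕ) : Fin (classCount ty s i) :=
    if h : p ∈ S i then E i ⟨p, h⟩ else ⟨0, hpos i⟩
  have hF (i : Fin k) (p : ℕ) (h : p ∈ S i) : F i p = E i ⟨p, h⟩ := dif_pos h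
  let v (p : ℕ) : (Σ i : Fin k, Fin (classCount ty s i)) ⊕ Sym2 (Fin k) :=
    (ty p).map (fun i => ⟨i, F i p⟩) id
  have hl {p : ℕ} {i : Fin k} (h : ty p = Sum.inl i) : v p = Sum.inl ⟨i, F i p⟩ := by
    simp [v, h]
  have hr {p : ℕ} {e : Sym2 (Fin k)} (h : ty p = Sum.inr e) : v p = Sum.inr e := by
    simp [v, h]
  have hv (p : ℕ) : (v p).map Sigma.fst id = ty p := by
    rcases h : ty p with i | e
    · simp [hl h]
    · simp [hr h]
  refine ⟨v, hv, ?_, ?_, ?_⟩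
  · intro p _
    rcases h : ty p with i | e
    · rw [hl h]
      exact Or.inl ⟨_, rfl⟩
    · rw [hr h]
      exact Or.inr ⟨e, hedge p e h, rfl⟩
  · intro p hp p' hp' heq
    have hty : ty p = ty p' := by rw [← hv p, ← hv p', heq]
    rcases h : ty p with i | e
    · have h' : ty p' = Sum.inl i := hty ▸ h
      have hm : p ∈ S i := mem_filter.2 ⟨mem_range.2 hp, h⟩
      have hm' : p' ∈ S i := mem_filter.2 ⟨mem_range.2 hp', h'⟩
      rw [hl h, hl h', hF i p hm, hF i p' hm'] at heq
      simpa using heq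
    · exact hinj p p' e h (hty ▸ h)
  · rintro _ (⟨⟨i, x⟩, rfl⟩ | ⟨e, he, rfl⟩)
    · let p := (E i).symm x
      have hm := p.2
      have hm' := mem_filter.1 hm
      refine ⟨p, mem_range.1 hm'.1, ?_⟩
      rw [hl hm'.2, hF i p hm]
      simp [p]
    · obtain ⟨p, hp, h⟩ := hex e he
      exact ⟨p, hp, hr h⟩

theorem take_drop_append_self_map_range {α : Type*} (v : ℕ → α) {k s i : ℕ} (hks : k ≤ s)
    (hi : i < s) :
    ((((List.range s).map v) ++ ((List.range s).map v)).drop i).take k =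
      (List.range k).map fun m => v ((i + m) % s) := by
  apply List.ext_getElem
  · simp
    omega
  · intro m h1 h2
    simp only [List.length_map, List.length_range] at h2
    simp only [List.getElem_take, List.getElem_drop, List.getElem_map, List.getElem_range,
      List.getElem_append, List.length_map, List.length_range]
    split_ifs with h
    · rw [Nat.mod_eq_of_lt h]
    · rw [Nat.mod_eq_sub_mod (by omega), Nat.mod_eq_of_lt (by omega)]

theorem image_univ_eq_image_range {k : ℕ} {α : Type*} [DecidableEq α] (w : ℕ → α)
    (f : Fin k → α) (hf : Function.Injective f) (h : ∀ y, ∃ m < k, w m = f y) :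
    (range k).image w = univ.image f := by
  symm
  apply eq_of_subset_of_card_le
  · intro x hx
    obtain ⟨y, -, rfl⟩ := mem_image.1 hx
    obtain ⟨m, hm, hw⟩ := h y
    exact mem_image.2 ⟨m, mem_range.2 hm, hw⟩
  · rw [card_image_of_injective _ hf]
    simpa using card_image_le (s := range k) (f := w)

/-- A cyclic sequence of types whose windows are transversal, up to pendant vertices, yields a
spanning tight cycle. -/
theorem fsHasSpanningCs_of_types {k s : ℕ} (hks : k ≤ s) (G : SimpleGraph (Fin k))
    (ty : ℕ → Fin k ⊕ Sym2 (Fin k))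
    (hpos : ∀ i, 1 ≤ classCount ty s i)
    (hedge : ∀ p e, ty p = Sum.inr e → e ∈ G.edgeSet)
    (hinj : ∀ p p' e, ty p = Sum.inr e → ty p' = Sum.inr e → p = p')
    (hex : ∀ e ∈ G.edgeSet, ∃ p < s, ty p = Sum.inr e)
    (hper : ∀ p < k, ty (s + p) = ty p)
    (hwin : ∀ i, (∀ y, ∃ m < k, ty (i + m) = Sum.inl y) ∨
      ∃ j u, G.Adj j u ∧ (∃ m < k, ty (i + m) = Sum.inr s(j, u)) ∧
        ∀ y ≠ j, ∃ m < k, ty (i + m) = Sum.inl y) :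
    FsHasSpanningCs k s (classCount ty s) G := by
  obtain ⟨v, hv, hbij⟩ := exists_labelling G ty hpos hedge hinj hex
  refine ⟨(List.range s).map v, ?_, by simp, ?_, ?_⟩
  · refine List.Nodup.map_on (fun x hx y hy h => ?_) List.nodup_range
    exact hbij.injOn (List.mem_range.1 hx) (List.mem_range.1 hy) h
  · rw [← hbij.image_eq]
    ext x
    simp
  · intro i hi
    simp only [List.length_map, List.length_range] at hi
    rw [take_drop_append_self_map_range v hks hi]
    have hset : ((List.range k).map fun m => v ((i + m) % s)).toFinset =
        (range k).image fun m => v ((i + m) % s) := by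
      ext x
      simp
    rw [hset]
    have hty (m : ℕ) (hm : m < k) : ty ((i + m) % s) = ty (i + m) := by
      rcases lt_or_ge (i + m) s with h | h
      · rw [Nat.mod_eq_of_lt h]
      · rw [Nat.mod_eq_sub_mod h, Nat.mod_eq_of_lt (by omega), ← hper (i + m - s) (by omega)]
        congr 1
        omega
    have hcore (y : Fin k) (h : ∃ m < k, ty (i + m) = Sum.inl y) :
        ∃ g : Fin (classCount ty s y), ∃ m < k, v ((i + m) % s) = Sum.inl ⟨y, g⟩ := by
      obtain ⟨m, hm, h⟩ := h
      have h1 := hv ((i + m) % s)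
      rw [hty m hm, h] at h1
      rcases h2 : v ((i + m) % s) with ⟨y', g⟩ | e
      · rw [h2] at h1
        obtain rfl : y' = y := by simpa using h1
        exact ⟨g, m, hm, h2⟩
      · simp [h2] at h1
    have hpend (e : Sym2 (Fin k)) (h : ∃ m < k, ty (i + m) = Sum.inr e) :
        ∃ m < k, v ((i + m) % s) = Sum.inr e := by
      obtain ⟨m, hm, h⟩ := h
      have h1 := hv ((i + m) % s)
      rw [hty m hm, h] at h1
      rcases h2 : v ((i + m) % s) with ⟨y', g⟩ | e'
      · simp [h2] at h1
      · rw [h2] at h1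
        obtain rfl : e' = e := by simpa using h1
        exact ⟨m, hm, h2⟩
    rcases hwin i with h | ⟨j, u, hju, hw, h⟩
    · choose g hg using fun y => hcore y (h y)
      refine Or.inl ⟨g, image_univ_eq_image_range _ _ (fun x y hxy => ?_) hg⟩
      have := congrArg (Sum.map Sigma.fst id) hxy
      simpa using this
    · have h' (y : Fin k) : ∃ g : Fin (classCount ty s y), y ≠ j →
          ∃ m < k, v ((i + m) % s) = Sum.inl ⟨y, g⟩ := by
        by_cases hy : y = j
        · exact ⟨⟨0, hpos y⟩, fun hne => absurd hy hne⟩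
        · obtain ⟨g, hg⟩ := hcore y (h y hy)
          exact ⟨g, fun _ => hg⟩
      choose g hg using h'
      refine Or.inr ⟨j, u, hju, g, ?_⟩
      let f (y : Fin k) : (Σ i : Fin k, Fin (classCount ty s i)) ⊕ Sym2 (Fin k) :=
        if y = j then Sum.inr s(j, u) else Sum.inl ⟨y, g y⟩
      have hfj : f j = Sum.inr s(j, u) := if_pos rfl
      have hfn (y : Fin k) (hy : y ≠ j) : f y = Sum.inl ⟨y, g y⟩ := if_neg hy
      rw [image_univ_eq_image_range _ f, ← insert_erase (mem_univ j), image_insert, hfj]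
      · congr 1
        rw [insert_erase (mem_univ j)]
        exact image_congr fun y hy => hfn y (ne_of_mem_erase (mem_coe.1 hy))
      · intro x y hxy
        by_cases hx : x = j <;> by_cases hy : y = j
        · rw [hx, hy]
        · rw [hx, hfj, hfn y hy] at hxy
          cases hxy
        · rw [hy, hfj, hfn x hx] at hxy
          cases hxy
        · rw [hfn x hx, hfn y hy] at hxy
          have := congrArg (Sum.map Sigma.fst id) hxy
          simpa using this
      · intro y
        by_cases hy : y = j
        · rw [hy, hfj]
          exact hpend _ hw
        · rw [hfn y hy]
          exact hg y hy

/-- The initial position of the class `y`: the classes are labelled so that, when `d` is the gcd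
of `k` and `r`, rotating by `r` moves class `y` to the position of class `y + d`. -/
def rotPos (k r y : ℕ) : ℕ := (y % k.gcd r + y / k.gcd r * r) % k

/-- The effect on labels of the first `T` swaps of the classes `e` and `e + d`. -/
def swapIndex (d T y : ℕ) : ℕ := if y < T then y + d else if y < d + T then y % d else y

/-- The number of swaps performed up to block `t`. -/
def swapCount (k d t : ℕ) : ℕ := min ((t + 1) / 2) (k - d)

/-- The position of the class `y` inside block `t`. -/
def slot (k r t y : ℕ) : ℕ :=
  rotPos k r (swapIndex (k.gcd r) (swapCount k (k.gcd r) t) y)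

section Slots

variable {k r : ℕ}

theorem rotPos_lt (hk : 0 < k) (y : ℕ) : rotPos k r y < k := Nat.mod_lt _ hk

theorem rotPos_of_lt (hk : 0 < k) {y : ℕ} (hy : y < k.gcd r) : rotPos k r y = y := by
  have := Nat.gcd_le_left r hk
  rw [rotPos, Nat.mod_eq_of_lt hy, Nat.div_eq_of_lt hy, zero_mul, add_zero,
    Nat.mod_eq_of_lt (by omega)]

theorem rotPos_mod_gcd (y : ℕ) : rotPos k r y % k.gcd r = y % k.gcd r := by
  rw [rotPos, Nat.mod_mod_of_dvd _ (Nat.gcd_dvd_left k r), Nat.add_mod,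
    Nat.mod_eq_zero_of_dvd ((Nat.gcd_dvd_right k r).mul_left _), add_zero, Nat.mod_mod,
    Nat.mod_mod]

theorem rotPos_injOn (hk : 0 < k) {y z : ℕ} (hy : y < k) (hz : z < k)
    (h : rotPos k r y = rotPos k r z) : y = z := by
  have h1 : y % k.gcd r = z % k.gcd r := by
    rw [← rotPos_mod_gcd, h, rotPos_mod_gcd]
  have h2 : y / k.gcd r * r ≡ z / k.gcd r * r [MOD k] := by
    refine Nat.ModEq.add_left_cancel' (y % k.gcd r) ?_
    change _ % _ = _ % _
    rw [rotPos, rotPos, ← h1] at h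
    exact h
  have h3 := Nat.ModEq.cancel_right_div_gcd hk h2
  have h4 : y / k.gcd r = z / k.gcd r :=
    h3.eq_of_lt_of_lt (Nat.div_lt_div_of_lt_of_dvd (Nat.gcd_dvd_left k r) hy)
      (Nat.div_lt_div_of_lt_of_dvd (Nat.gcd_dvd_left k r) hz)
  rw [← Nat.mod_add_div y (k.gcd r), ← Nat.mod_add_div z (k.gcd r), h1, h4]

theorem gcd_le_rotPos (hk : 0 < k) {y : ℕ} (hy : k.gcd r ≤ y) (hyk : y < k) :
    k.gcd r ≤ rotPos k r y := by
  by_contra! h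
  have h1 : rotPos k r (rotPos k r y) = rotPos k r y := rotPos_of_lt hk h
  have h2 := rotPos_injOn hk (rotPos_lt hk y) hyk h1
  omega

theorem rotPos_add_gcd (hk : 0 < k) (y : ℕ) :
    rotPos k r (y + k.gcd r) = (rotPos k r y + r) % k := by
  rw [rotPos, rotPos, Nat.add_mod_right, Nat.add_div_right _ (Nat.gcd_pos_of_pos_left r hk),
    Nat.mod_add_mod, Nat.succ_mul, add_assoc]

theorem rotPos_add_mod_of_le (hk : 0 < k) {y : ℕ} (h : k - k.gcd r ≤ y) (hy : y < k) :
    (rotPos k r y + r) % k = y % k.gcd r := by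
  have hd := Nat.gcd_pos_of_pos_left r hk
  have hdk := Nat.gcd_le_left r hk
  obtain ⟨n, hn⟩ := Nat.gcd_dvd_left k r
  obtain ⟨c, hc⟩ := Nat.gcd_dvd_right k r
  rw [← rotPos_add_gcd hk, rotPos, ← Nat.add_mod_right y]
  generalize k.gcd r = d at *
  obtain ⟨z, hz⟩ : ∃ z, y + d = z + d * n := ⟨y + d - k, by omega⟩
  have hzd : z < d := by omega
  rw [hz, Nat.add_mul_mod_self_left, Nat.add_mul_div_left _ _ hd, Nat.mod_eq_of_lt hzd,
    Nat.div_eq_of_lt hzd, zero_add]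
  have : n * r = k * c := by
    rw [hc, hn]
    ring
  rw [this, Nat.add_mul_mod_self_left, Nat.mod_eq_of_lt (by omega)]

theorem swapIndex_lt {d T y : ℕ} (hd : 0 < d) (hT : T ≤ k - d) (hdk : d ≤ k) (hy : y < k) :
    swapIndex d T y < k := by
  have := Nat.mod_lt y hd
  unfold swapIndex
  split_ifs <;> omega

theorem swapIndex_injective {d T : ℕ} (hd : 0 < d) : Function.Injective (swapIndex d T) := by
  intro y z h
  have h1 := Nat.mod_lt y hd
  have h2 := Nat.mod_lt z hd
  unfold swapIndex at h
  split_ifs at h with h3 h4 h5 h6 h7 h8 <;> try omega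
  have h9 : (y : ℤ) ≡ z [ZMOD d] := (Int.natCast_modEq_iff).2 h
  have := h9.dvd
  have h10 : (z : ℤ) - y = 0 := Int.eq_zero_of_abs_lt_dvd this (by rw [abs_lt]; omega)
  omega

theorem slot_lt (hk : 0 < k) (t y : ℕ) : slot k r t y < k := rotPos_lt hk _

theorem slot_injOn (hk : 0 < k) {t y z : ℕ} (hy : y < k) (hz : z < k)
    (h : slot k r t y = slot k r t z) : y = z := by
  have hd := Nat.gcd_pos_of_pos_left r hk
  have hdk := Nat.gcd_le_left r hk
  refine swapIndex_injective hd (rotPos_injOn hk ?_ ?_ h) <;>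
  exact swapIndex_lt hd (min_le_right _ _) hdk (by assumption)

theorem slot_zero (hk : 0 < k) {y : ℕ} : slot k r 0 y = rotPos k r y := by
  have hd := Nat.gcd_pos_of_pos_left r hk
  have h : swapIndex (k.gcd r) 0 y = y := by
    unfold swapIndex
    split_ifs with h1 h2
    · omega
    · exact Nat.mod_eq_of_lt (by omega)
    · rfl
  simp [slot, swapCount, h]

theorem slot_of_le (hk : 0 < k) {t y : ℕ} (ht : 2 * k ≤ t) (hy : y < k) :
    slot k r t y = (rotPos k r y + r) % k := by
  have hd := Nat.gcd_pos_of_pos_left r hk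
  have hdk := Nat.gcd_le_left r hk
  have h1 : swapCount k (k.gcd r) t = k - k.gcd r := min_eq_right (by omega)
  rw [slot, h1, swapIndex]
  split_ifs with h2 h3
  · exact rotPos_add_gcd hk y
  · rw [rotPos_of_lt hk (Nat.mod_lt _ hd), rotPos_add_mod_of_le hk (by omega) hy]
  · omega

theorem slot_even_eq_slot_succ {e y : ℕ} (hy : k.gcd r + e < k → y ≠ e ∧ y ≠ k.gcd r + e) :
    slot k r (2 * e) y = slot k r (2 * e + 1) y := by
  rcases lt_or_ge (k.gcd r + e) k with h | h
  · obtain ⟨h1, h2⟩ := hy h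
    have h3 : swapCount k (k.gcd r) (2 * e) = e := by unfold swapCount; omega
    have h4 : swapCount k (k.gcd r) (2 * e + 1) = e + 1 := by unfold swapCount; omega
    rw [slot, slot, h3, h4]
    congr 1
    unfold swapIndex
    split_ifs <;> first | rfl | omega
  · have : swapCount k (k.gcd r) (2 * e) = swapCount k (k.gcd r) (2 * e + 1) := by
      unfold swapCount
      omega
    rw [slot, slot, this]

theorem slot_odd_eq_slot_succ (e y : ℕ) :
    slot k r (2 * e + 1) y = slot k r (2 * e + 2) y := by
  have : swapCount k (k.gcd r) (2 * e + 1) = swapCount k (k.gcd r) (2 * e + 2) := by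
    unfold swapCount
    omega
  rw [slot, slot, this]

theorem slot_even_low (hk : 0 < k) {e : ℕ} (he : k.gcd r + e < k) :
    slot k r (2 * e) e = e % k.gcd r := by
  have hd := Nat.gcd_pos_of_pos_left r hk
  have h3 : swapCount k (k.gcd r) (2 * e) = e := by unfold swapCount; omega
  rw [slot, h3, swapIndex, if_neg (by omega), if_pos (by omega),
    rotPos_of_lt hk (Nat.mod_lt _ hd)]

theorem slot_even_high {e : ℕ} (he : k.gcd r + e < k) :
    slot k r (2 * e) (k.gcd r + e) = rotPos k r (k.gcd r + e) := by
  have h3 : swapCount k (k.gcd r) (2 * e) = e := by unfold swapCount; omega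
  rcases Nat.eq_zero_or_pos (k.gcd r) with h0 | h0
  · simp [slot, swapIndex, h0]
  · rw [slot, h3, swapIndex, if_neg (by omega), if_neg (by omega)]

theorem slot_odd_low {e : ℕ} (he : k.gcd r + e < k) :
    slot k r (2 * e + 1) e = rotPos k r (k.gcd r + e) := by
  have h3 : swapCount k (k.gcd r) (2 * e + 1) = e + 1 := by unfold swapCount; omega
  rw [slot, h3, swapIndex, if_pos (by omega), add_comm]

theorem slot_odd_high (hk : 0 < k) {e : ℕ} (he : k.gcd r + e < k) :
    slot k r (2 * e + 1) (k.gcd r + e) = e % k.gcd r := by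
  have hd := Nat.gcd_pos_of_pos_left r hk
  have h3 : swapCount k (k.gcd r) (2 * e + 1) = e + 1 := by unfold swapCount; omega
  rw [slot, h3, swapIndex, if_neg (by omega), if_pos (by omega), Nat.add_mod_left,
    rotPos_of_lt hk (Nat.mod_lt _ hd)]

end Slots

/-- The class `y` is replaced by a pendant vertex in block `t`. -/
def IsReplaced (k r t y : ℕ) : Prop := t % 2 = 1 ∧ y = k.gcd r + t / 2

/-- `ty` lists, block by block, the classes in the order prescribed by `slot`, with one pendant
vertex in place of the class replaced in each block. -/
structure IsTypeSeq (k r : ℕ) (ty : ℕ → Fin k ⊕ Sym2 (Fin k)) : Prop where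
  core : ∀ t (y : Fin k), ¬ IsReplaced k r t y → ty (t * k + slot k r t y) = Sum.inl y
  pendant : ∀ t (x y : Fin k), IsReplaced k r t y → (x : ℕ) + k.gcd r = y →
    ty (t * k + slot k r t y) = Sum.inr s(x, y)

theorem exists_eq_block {k : ℕ} (r : ℕ) (hk : 0 < k) (p : ℕ) :
    ∃ y : Fin k, p = p / k * k + slot k r (p / k) y := by
  have hinj : Function.Injective fun y : Fin k =>
      (⟨slot k r (p / k) y, slot_lt hk _ _⟩ : Fin k) := fun y z h =>
    Fin.ext (slot_injOn hk y.2 z.2 (congrArg Fin.val h))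
  obtain ⟨y, hy⟩ := (Finite.injective_iff_surjective.1 hinj) ⟨p % k, Nat.mod_lt _ hk⟩
  refine ⟨y, ?_⟩
  have : slot k r (p / k) y = p % k := congrArg Fin.val hy
  rw [this, Nat.div_add_mod']

theorem block_div {k : ℕ} (r : ℕ) (hk : 0 < k) (t y : ℕ) :
    (t * k + slot k r t y) / k = t := by
  rw [add_comm, Nat.add_mul_div_right _ _ hk, Nat.div_eq_of_lt (slot_lt hk _ _), zero_add]

theorem block_injective {k r t t' : ℕ} (hk : 0 < k) {y y' : Fin k}
    (h : t * k + slot k r t y = t' * k + slot k r t' y') : t = t' ∧ y = y' := by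
  have h1 : t = t' := by rw [← block_div r hk t y, h, block_div r hk]
  subst h1
  exact ⟨rfl, Fin.ext (slot_injOn hk y.2 y'.2 (Nat.add_left_cancel h))⟩

theorem exists_isTypeSeq {k : ℕ} (r : ℕ) (hk : 0 < k) :
    ∃ ty : ℕ → Fin k ⊕ Sym2 (Fin k), IsTypeSeq k r ty := by
  classical
  choose cls hcls using exists_eq_block r hk
  have hc (t : ℕ) (y : Fin k) : cls (t * k + slot k r t y) = y :=
    (block_injective hk (hcls (t * k + slot k r t y))).2.symm
  refine ⟨fun p => if IsReplaced k r (p / k) (cls p) then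
      Sum.inr s(⟨cls p - k.gcd r, by omega⟩, cls p) else Sum.inl (cls p), ?_, ?_⟩
  · intro t y h
    simp only [block_div r hk, hc, if_neg h]
  · intro t x y h hxy
    simp only [block_div r hk, hc, if_pos h, Sum.inr.injEq]
    exact congrArg (fun z => s(z, y)) (Fin.ext (Nat.sub_eq_of_eq_add hxy.symm))

namespace IsTypeSeq

variable {k r : ℕ} {ty : ℕ → Fin k ⊕ Sym2 (Fin k)}

theorem exists_of_eq_inr (h : IsTypeSeq k r ty) (hk : 0 < k) {p : ℕ} {e : Sym2 (Fin k)}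
    (he : ty p = Sum.inr e) :
    ∃ (t : ℕ) (x y : Fin k), IsReplaced k r t y ∧ (x : ℕ) + k.gcd r = y ∧ e = s(x, y) ∧
      p = t * k + slot k r t y := by
  obtain ⟨y, hy⟩ := exists_eq_block r hk p
  generalize p / k = t at hy
  subst hy
  by_cases hrep : IsReplaced k r t y
  · have hle : k.gcd r ≤ y := hrep.2 ▸ Nat.le_add_right _ _
    have hxy : ((⟨y - k.gcd r, by omega⟩ : Fin k) : ℕ) + k.gcd r = y := Nat.sub_add_cancel hle
    rw [h.pendant t _ y hrep hxy] at he
    exact ⟨t, _, y, hrep, hxy, (Sum.inr_injective he).symm, rfl⟩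
  · rw [h.core t y hrep] at he
    cases he

theorem eq_inl_iff (h : IsTypeSeq k r ty) (hk : 0 < k) {p : ℕ} {y : Fin k} :
    ty p = Sum.inl y ↔ ∃ t, ¬ IsReplaced k r t y ∧ p = t * k + slot k r t y := by
  constructor
  · intro he
    obtain ⟨z, hz⟩ := exists_eq_block r hk p
    generalize p / k = t at hz
    subst hz
    by_cases hrep : IsReplaced k r t z
    · have hle : k.gcd r ≤ z := hrep.2 ▸ Nat.le_add_right _ _
      rw [h.pendant t ⟨z - k.gcd r, by omega⟩ z hrep (Nat.sub_add_cancel hle)] at he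
      cases he
    · rw [h.core t z hrep] at he
      obtain rfl := Sum.inl_injective he
      exact ⟨t, hrep, rfl⟩
  · rintro ⟨t, hrep, rfl⟩
    exact h.core t y hrep

theorem mem_edgeSet (h : IsTypeSeq k r ty) (hk : 0 < k) (p : ℕ) (e : Sym2 (Fin k))
    (he : ty p = Sum.inr e) : e ∈ (stepGraph k (k.gcd r)).edgeSet := by
  obtain ⟨t, x, y, -, hxy, rfl, -⟩ := h.exists_of_eq_inr hk he
  exact (stepGraph_adj (Nat.gcd_pos_of_pos_left r hk)).2 (Or.inl hxy)

theorem eq_of_eq_inr (h : IsTypeSeq k r ty) (hk : 0 < k) (p p' : ℕ) (e : Sym2 (Fin k))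
    (he : ty p = Sum.inr e) (he' : ty p' = Sum.inr e) : p = p' := by
  obtain ⟨t, x, y, hrep, hxy, rfl, rfl⟩ := h.exists_of_eq_inr hk he
  obtain ⟨t', x', y', hrep', hxy', heq, rfl⟩ := h.exists_of_eq_inr hk he'
  have hd := Nat.gcd_pos_of_pos_left r hk
  have hy : y = y' := by
    rcases Sym2.eq_iff.1 heq with ⟨-, hy⟩ | ⟨rfl, rfl⟩
    · exact hy
    · omega
  subst hy
  have : t = t' := by
    unfold IsReplaced at hrep hrep'
    omega
  rw [this]

theorem exists_eq_inr (h : IsTypeSeq k r ty) (hk : 0 < k) {s : ℕ} (hs : 2 * k * k ≤ s)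
    (e : Sym2 (Fin k)) (he : e ∈ (stepGraph k (k.gcd r)).edgeSet) :
    ∃ p < s, ty p = Sum.inr e := by
  have hd := Nat.gcd_pos_of_pos_left r hk
  have key (x y : Fin k) (hxy : (x : ℕ) + k.gcd r = y) : ∃ p < s, ty p = Sum.inr s(x, y) := by
    refine ⟨_, ?_, h.pendant (2 * x + 1) x y ⟨by omega, by omega⟩ hxy⟩
    have h1 := slot_lt (r := r) hk (2 * x + 1) y
    have h2 : (2 * (x : ℕ) + 1 + 1) * k ≤ 2 * k * k := Nat.mul_le_mul_right _ (by omega)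
    rw [Nat.succ_mul] at h2
    omega
  induction e with
  | _ x y =>
    rcases (stepGraph_adj hd).1 he with hxy | hxy
    · exact key x y hxy
    · rw [Sym2.eq_swap]
      exact key y x hxy

theorem periodic (h : IsTypeSeq k r ty) (hk : 0 < k) (hr : r < k) {q : ℕ} (hq : 2 * k ≤ q)
    {p : ℕ} (hp : p < k) : ty (q * k + r + p) = ty p := by
  obtain ⟨y, hy⟩ := exists_eq_block r hk p
  rw [Nat.div_eq_of_lt hp] at hy
  have h0 : ty p = Sum.inl y := (h.eq_inl_iff hk).2 ⟨0, by simp [IsReplaced], hy⟩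
  rw [h0, h.eq_inl_iff hk]
  rw [slot_zero hk, zero_mul, zero_add] at hy
  have hnr (t : ℕ) (ht : 2 * k ≤ t) : ¬ IsReplaced k r t y := by
    unfold IsReplaced
    omega
  rcases lt_or_ge (p + r) k with hlt | hge
  · refine ⟨q, hnr q hq, ?_⟩
    rw [slot_of_le hk hq y.2, ← hy, Nat.mod_eq_of_lt hlt]
    omega
  · refine ⟨q + 1, hnr _ (by omega), ?_⟩
    rw [slot_of_le hk (by omega) y.2, ← hy, Nat.mod_eq_sub_mod hge,
      Nat.mod_eq_of_lt (by omega), Nat.succ_mul]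
    omega

theorem window (h : IsTypeSeq k r ty) (hk : 0 < k) (i : ℕ) :
    (∀ y, ∃ m < k, ty (i + m) = Sum.inl y) ∨
      ∃ j u, (stepGraph k (k.gcd r)).Adj j u ∧ (∃ m < k, ty (i + m) = Sum.inr s(j, u)) ∧
        ∀ y ≠ j, ∃ m < k, ty (i + m) = Sum.inl y := by
  have hd := Nat.gcd_pos_of_pos_left r hk
  obtain ⟨t, a, ha, rfl⟩ : ∃ t a, a < k ∧ i = t * k + a :=
    ⟨i / k, i % k, Nat.mod_lt _ hk, (Nat.div_add_mod' i k).symm⟩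
  have hfst {y : ℕ} {z : Fin k ⊕ Sym2 (Fin k)} (hz : ty (t * k + slot k r t y) = z)
      (hy : a ≤ slot k r t y) : ∃ m < k, ty (t * k + a + m) = z := by
    have := slot_lt (r := r) hk t y
    refine ⟨slot k r t y - a, by omega, ?_⟩
    rw [← hz]
    congr 1
    omega
  have hsnd {y : ℕ} {z : Fin k ⊕ Sym2 (Fin k)}
      (hz : ty ((t + 1) * k + slot k r (t + 1) y) = z)
      (hy : slot k r (t + 1) y < a) : ∃ m < k, ty (t * k + a + m) = z := by
    refine ⟨k + slot k r (t + 1) y - a, by omega, ?_⟩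
    rw [← hz, Nat.succ_mul]
    congr 1
    omega
  have heq {y : Fin k} (h1 : slot k r t y = slot k r (t + 1) y) (h2 : ¬ IsReplaced k r t y)
      (h3 : ¬ IsReplaced k r (t + 1) y) : ∃ m < k, ty (t * k + a + m) = Sum.inl y := by
    rcases le_or_gt a (slot k r t y) with hle | hlt
    · exact hfst (h.core t y h2) hle
    · exact hsnd (h.core (t + 1) y h3) (h1 ▸ hlt)
  obtain ⟨e, rfl | rfl⟩ : ∃ e, t = 2 * e ∨ t = 2 * e + 1 := ⟨t / 2, by omega⟩
  · have hn (y : ℕ) : ¬ IsReplaced k r (2 * e) y := by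
      unfold IsReplaced
      omega
    have hn' (y : ℕ) (hy : y ≠ k.gcd r + e) : ¬ IsReplaced k r (2 * e + 1) y := by
      unfold IsReplaced
      omega
    rcases lt_or_ge (k.gcd r + e) k with he | he
    · let lo : Fin k := ⟨e, by omega⟩
      let hi : Fin k := ⟨k.gcd r + e, he⟩
      have hother (y : Fin k) (h1 : y ≠ lo) (h2 : y ≠ hi) :
          ∃ m < k, ty ((2 * e) * k + a + m) = Sum.inl y := by
        have h1' : (y : ℕ) ≠ e := fun hc => h1 (Fin.ext hc)
        have h2' : (y : ℕ) ≠ k.gcd r + e := fun hc => h2 (Fin.ext hc)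
        exact heq (slot_even_eq_slot_succ fun _ => ⟨h1', h2'⟩) (hn y) (hn' y h2')
      have hadj : (stepGraph k (k.gcd r)).Adj lo hi :=
        (stepGraph_adj hd).2 (Or.inl (add_comm _ _))
      have hpend : ty ((2 * e + 1) * k + slot k r (2 * e + 1) hi) = Sum.inr s(lo, hi) :=
        h.pendant _ lo hi ⟨by omega, by simp only [hi]; omega⟩ (add_comm _ _)
      have hlo := h.core (2 * e) lo (hn lo)
      have hhi := h.core (2 * e) hi (hn hi)
      have hlo' := h.core (2 * e + 1) lo (hn' lo (by simp only [lo]; omega))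
      have s1 : slot k r (2 * e) lo = e % k.gcd r := slot_even_low hk he
      have s2 : slot k r (2 * e) hi = rotPos k r (k.gcd r + e) := slot_even_high he
      have s3 : slot k r (2 * e + 1) lo = rotPos k r (k.gcd r + e) := slot_odd_low he
      have s4 : slot k r (2 * e + 1) hi = e % k.gcd r := slot_odd_high hk he
      have hP := gcd_le_rotPos (r := r) hk (Nat.le_add_right _ e) he
      have hc := Nat.mod_lt e hd
      rcases le_or_gt a (e % k.gcd r) with h1 | h1
      · left
        intro y
        by_cases hy1 : y = lo
        · exact hy1 ▸ hfst hlo (by omega)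
        by_cases hy2 : y = hi
        · exact hy2 ▸ hfst hhi (by omega)
        exact hother y hy1 hy2
      right
      rcases le_or_gt a (rotPos k r (k.gcd r + e)) with h2 | h2
      · refine ⟨lo, hi, hadj, hsnd hpend (by omega), fun y hy1 => ?_⟩
        by_cases hy2 : y = hi
        · exact hy2 ▸ hfst hhi (by omega)
        exact hother y hy1 hy2
      · refine ⟨hi, lo, hadj.symm, Sym2.eq_swap (a := lo) (b := hi) ▸ hsnd hpend (by omega),
          fun y hy2 => ?_⟩
        by_cases hy1 : y = lo
        · exact hy1 ▸ hsnd hlo' (by omega)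
        exact hother y hy1 hy2
    · left
      intro y
      exact heq (slot_even_eq_slot_succ fun hc => absurd hc (by omega)) (hn y)
        (hn' y (by omega))
  · have hn (y : ℕ) : ¬ IsReplaced k r (2 * e + 1 + 1) y := by
      unfold IsReplaced
      omega
    have hn' (y : ℕ) (hy : y ≠ k.gcd r + e) : ¬ IsReplaced k r (2 * e + 1) y := by
      unfold IsReplaced
      omega
    have hother (y : Fin k) (h2 : (y : ℕ) ≠ k.gcd r + e) :
        ∃ m < k, ty ((2 * e + 1) * k + a + m) = Sum.inl y :=
      heq (slot_odd_eq_slot_succ e y) (hn' y h2) (hn y)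
    rcases lt_or_ge (k.gcd r + e) k with he | he
    · let lo : Fin k := ⟨e, by omega⟩
      let hi : Fin k := ⟨k.gcd r + e, he⟩
      have hadj : (stepGraph k (k.gcd r)).Adj hi lo :=
        (stepGraph_adj hd).2 (Or.inr (add_comm _ _))
      have hpend : ty ((2 * e + 1) * k + slot k r (2 * e + 1) hi) = Sum.inr s(hi, lo) := by
        rw [Sym2.eq_swap]
        exact h.pendant _ lo hi ⟨by omega, by simp only [hi]; omega⟩ (add_comm _ _)
      rcases le_or_gt a (slot k r (2 * e + 1) hi) with h1 | h1
      · exact Or.inr ⟨hi, lo, hadj, hfst hpend h1,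
          fun y hy => hother y fun hc => hy (Fin.ext hc)⟩
      · left
        intro y
        by_cases hy : y = hi
        · refine hy ▸ hsnd (h.core (2 * e + 1 + 1) hi (hn hi)) ?_
          rwa [slot_odd_eq_slot_succ e hi] at h1
        · exact hother y fun hc => hy (Fin.ext hc)
    · exact Or.inl fun y => hother y (by omega)

theorem classCount_eq (h : IsTypeSeq k r ty) (hk : 0 < k) (s : ℕ) (y : Fin k) {N : ℕ}
    (hN : s ≤ N * k) [DecidablePred fun t => IsReplaced k r t y] :
    classCount ty s y =
      ((range N).filter fun t => ¬ IsReplaced k r t y ∧ t * k + slot k r t y < s).card := by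
  symm
  refine card_bij (fun t _ => t * k + slot k r t y) ?_ ?_ ?_
  · intro t ht
    simp only [mem_filter, mem_range] at ht ⊢
    exact ⟨ht.2.2, h.core t y ht.2.1⟩
  · intro t _ t' _ heq
    exact (block_injective hk heq).1
  · intro p hp
    simp only [mem_filter, mem_range] at hp
    obtain ⟨t, ht, rfl⟩ := (h.eq_inl_iff hk).1 hp.2
    refine ⟨t, ?_, rfl⟩
    simp only [mem_filter, mem_range]
    refine ⟨?_, ht, hp.1⟩
    by_contra! hle
    have := Nat.mul_le_mul_right k hle
    omega

theorem le_classCount (h : IsTypeSeq k r ty) (hk : 0 < k) (hr : r < k) (q : ℕ) (y : Fin k) :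
    q - 1 ≤ classCount ty (q * k + r) y := by
  classical
  rw [h.classCount_eq hk _ y (N := q + 1) (by rw [Nat.succ_mul]; omega)]
  have hsub : (range q).erase (2 * (y - k.gcd r) + 1) ⊆ (range (q + 1)).filter
      fun t => ¬ IsReplaced k r t y ∧ t * k + slot k r t y < q * k + r := by
    intro t ht
    simp only [mem_erase, mem_range, mem_filter] at ht ⊢
    refine ⟨by omega, ?_, ?_⟩
    · unfold IsReplaced
      omega
    · have h1 := Nat.mul_le_mul_right k (Nat.succ_le_of_lt ht.2)
      have h2 := slot_lt (r := r) hk t y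
      rw [Nat.succ_mul] at h1
      omega
  calc q - 1 = (range q).card - 1 := by simp
    _ ≤ _ := pred_card_le_card_erase
    _ ≤ _ := card_le_card hsub

theorem classCount_le (h : IsTypeSeq k r ty) (hk : 0 < k) (hr : r < k) {q : ℕ}
    (hq : 2 * k ≤ q) (y : Fin k) : classCount ty (q * k + r) y ≤ q := by
  classical
  have hd := Nat.gcd_pos_of_pos_left r hk
  rw [h.classCount_eq hk _ y (N := q + 1) (by rw [Nat.succ_mul]; omega)]
  rcases lt_or_ge (y : ℕ) (k.gcd r) with hy | hy
  · have hsub : ((range (q + 1)).filter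
        fun t => ¬ IsReplaced k r t y ∧ t * k + slot k r t y < q * k + r) ⊆ range q := by
      intro t ht
      simp only [mem_range, mem_filter] at ht ⊢
      by_contra! hle
      obtain rfl : t = q := by omega
      have h1 : k.gcd r ≤ k - r :=
        Nat.le_of_dvd (by omega) (Nat.dvd_sub (Nat.gcd_dvd_left k r) (Nat.gcd_dvd_right k r))
      have h2 : slot k r t y = y + r := by
        rw [slot_of_le hk hq y.2, rotPos_of_lt hk hy, Nat.mod_eq_of_lt (by omega)]
      omega
    simpa using card_le_card hsub
  · have hsub : ((range (q + 1)).filter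
        fun t => ¬ IsReplaced k r t y ∧ t * k + slot k r t y < q * k + r) ⊆
          (range (q + 1)).erase (2 * (y - k.gcd r) + 1) := by
      intro t ht
      simp only [mem_erase, mem_range, mem_filter] at ht ⊢
      refine ⟨?_, ht.1⟩
      rintro rfl
      refine ht.2.1 ⟨by omega, by omega⟩
    have := card_le_card hsub
    rwa [card_erase_of_mem (mem_range.2 (by omega)), card_range, Nat.add_sub_cancel] at this

end IsTypeSeq

/-- for `k ≥ 3`, `s ≥ 2k²` with `k ∤ s` there are a union-of-paths graph `G_s`
on `[k]`, positive integers `a_{s,1}, …, a_{s,k}` and `ℓ`, with `|a_{s,i} - a_{s,j}| ≤ 1`,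
`ℓ = |E(G_s)| ≤ k - 1`, `ℓ + ∑ a_{s,i} = s`, such that `F_s = F(K^k(a), G_s)` satisfies
`|V(F_s) ∖ V(K)| = ℓ` and contains a spanning copy of `C_s^k`. -/
theorem exists_Fs (k s : ℕ) (hk : 3 ≤ k) (hs : 2 * k ^ 2 ≤ s) (hnd : ¬ k ∣ s) :
    ∃ (G : SimpleGraph (Fin k)) (a : Fin k → ℕ) (ℓ : ℕ),
      IsUnionOfPaths k G ∧ (∀ i, 1 ≤ a i) ∧
      (∀ i j, |(a i : ℤ) - (a j : ℤ)| ≤ 1) ∧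
      G.edgeSet.ncard = ℓ ∧ 1 ≤ ℓ ∧ ℓ ≤ k - 1 ∧ ℓ + ∑ i, a i = s ∧
      FsHasSpanningCs k s a G := by
  have hk0 : 0 < k := by omega
  obtain ⟨q, r, hr, rfl⟩ : ∃ q r, r < k ∧ s = q * k + r :=
    ⟨s / k, s % k, Nat.mod_lt _ hk0, (Nat.div_add_mod' s k).symm⟩
  have hr0 : 0 < r := Nat.pos_of_ne_zero fun h => hnd (by simp [h])
  have hs' : 2 * k * k ≤ q * k + r := by rwa [mul_assoc, ← sq]
  have hq : 2 * k ≤ q := by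
    by_contra! hlt
    have := Nat.mul_le_mul_right k (Nat.succ_le_of_lt hlt)
    rw [Nat.succ_mul] at this
    omega
  have hd := Nat.gcd_pos_of_pos_left r hk0
  have hdk : k.gcd r < k := (Nat.gcd_le_right k hr0).trans_lt hr
  obtain ⟨ty, hty⟩ := exists_isTypeSeq r hk0
  have hlow := hty.le_classCount hk0 hr q
  have hupp := hty.classCount_le hk0 hr hq
  have hpos (i : Fin k) : 1 ≤ classCount ty (q * k + r) i := by
    have := hlow i
    omega
  have hC := fsHasSpanningCs_of_types (s := q * k + r) (by nlinarith) (stepGraph k (k.gcd r)) ty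
    hpos (hty.mem_edgeSet hk0) (hty.eq_of_eq_inr hk0) (hty.exists_eq_inr hk0 hs')
    (fun p hp => hty.periodic hk0 hr hq hp) (hty.window hk0)
  refine ⟨_, _, _, isUnionOfPaths_stepGraph hd (Nat.gcd_dvd_left k r), hpos, fun i j => ?_, rfl,
    ncard_edgeSet_stepGraph_pos hd hdk, (ncard_edgeSet_stepGraph_le hd).trans (by omega),
    ncard_edgeSet_add_sum_eq hC, hC⟩
  have h1 := hlow i
  have h2 := hlow j
  have h3 := hupp i
  have h4 := hupp j
  rw [abs_le]
  omega
end

section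
/- For all integers k ≥ 3 and s ≥ 1 there exist c > 0 and n₀ ∈ ℕ such that for all n ≥ n₀: every k-graph H on n vertices with δ_{k−1}(H) ≥ c·n^{1 − 1/s^{k−1}} has a K^k(s)-covering, where K^k(s) is the balanced complete k-partite k-graph with all k vertex classes of size s. (In other words, c_{k−1}(n, K^k(s)) ≤ c·n^{1 − 1/s^{k−1}}.) -/
set_option autoImplicit false

open Finset

open Function BigOperators

section Expect

variable {α β : Type*} [Fintype α] [Fintype β]

/-- The real-valued indicator of a proposition. -/
noncomputable def propInd (p : Prop) : ℝ := open Classical in if p then 1 else 0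

lemma propInd_nonneg (p : Prop) : 0 ≤ propInd p := by
  unfold propInd; split_ifs <;> norm_num

lemma propInd_le_one (p : Prop) : propInd p ≤ 1 := by
  unfold propInd; split_ifs <;> norm_num

lemma propInd_of {p : Prop} (h : p) : propInd p = 1 := by simp [propInd, h]

lemma propInd_of_not {p : Prop} (h : ¬ p) : propInd p = 0 := by simp [propInd, h]

lemma propInd_mono {p q : Prop} (h : p → q) : propInd p ≤ propInd q := by
  by_cases hp : p
  · rw [propInd_of hp, propInd_of (h hp)]
  · rw [propInd_of_not hp]; exact propInd_nonneg q

lemma propInd_le_add {p q r : Prop} (h : p → q ∨ r) : propInd p ≤ propInd q + propInd r := by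
  by_cases hp : p
  · rcases h hp with hq | hr
    · rw [propInd_of hp, propInd_of hq]; linarith [propInd_nonneg r]
    · rw [propInd_of hp, propInd_of hr]; linarith [propInd_nonneg q]
  · rw [propInd_of_not hp]; exact add_nonneg (propInd_nonneg q) (propInd_nonneg r)

lemma prod_propInd (p : α → Prop) : ∏ a, propInd (p a) = propInd (∀ a, p a) := by
  classical
  simp [propInd, Finset.prod_boole]

lemma expect_propInd (p : α → Prop) [DecidablePred p] :
    𝔼 a, propInd (p a) = (#{a | p a} : ℝ) / Fintype.card α := by
  have h : ∀ a, propInd (p a) = if p a then 1 else 0 := fun a => by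
    by_cases ha : p a <;> simp [propInd, ha]
  simp [h, Fintype.expect_eq_sum_div_card]

lemma expect_fin_cons (m : ℕ) (f : (Fin (m + 1) → α) → ℝ) :
    𝔼 x, f x = 𝔼 y : α, 𝔼 x : Fin m → α, f (Fin.cons y x) := by
  rw [← Finset.expect_product' univ univ fun (y : α) (x : Fin m → α) =>
    f (Fin.cons y x : Fin (m + 1) → α), Finset.univ_product_univ]
  exact (Fintype.expect_equiv (Fin.consEquiv fun _ : Fin (m + 1) => α) _ _ fun _ => rfl).symm

lemma pow_expect_le_expect_pow [Nonempty α] {f : α → ℝ} (hf : ∀ a, 0 ≤ f a) (n : ℕ) :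
    (𝔼 a, f a) ^ n ≤ 𝔼 a, f a ^ n := by
  have hc : (Fintype.card α : ℝ) ≠ 0 := by simp
  have := Real.pow_arith_mean_le_arith_mean_pow univ (fun _ : α => (Fintype.card α : ℝ)⁻¹) f
    (fun _ _ => by positivity) (by simp [hc]) (fun a _ => hf a) n
  simpa [Fintype.expect_eq_sum_div_card, div_eq_inv_mul, Finset.mul_sum] using this

/-- The density of blow-ups of a single edge in a weighted `m`-partite `m`-graph is at least
the corresponding power of the edge density. -/
lemma pow_expect_le_expect_prod [Nonempty α] (s : ℕ) : ∀ (m : ℕ) (φ : (Fin m → α) → ℝ),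
    (∀ x, 0 ≤ φ x) → (𝔼 x, φ x) ^ s ^ m ≤
      𝔼 X : Fin m → Fin s → α, ∏ g : Fin m → Fin s, φ fun i => X i (g i)
  | 0, φ, _ => by
    have h : ∀ x, φ x = φ default := fun x => congrArg φ (Subsingleton.elim _ _)
    simp [h]
  | m + 1, φ, hφ => by
    calc (𝔼 x, φ x) ^ s ^ (m + 1)
        = ((𝔼 x : Fin m → α, 𝔼 y : α, φ (Fin.cons y x)) ^ s) ^ s ^ m := by
          rw [expect_fin_cons, Finset.expect_comm, pow_succ', pow_mul]
      _ ≤ (𝔼 x : Fin m → α, (𝔼 y : α, φ (Fin.cons y x)) ^ s) ^ s ^ m := by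
          gcongr
          · exact pow_nonneg (Finset.expect_nonneg fun x _ =>
              Finset.expect_nonneg fun y _ => hφ _) _
          · exact pow_expect_le_expect_pow (fun x => Finset.expect_nonneg fun y _ => hφ _) s
      _ = (𝔼 Y : Fin s → α, 𝔼 x : Fin m → α, ∏ a, φ (Fin.cons (Y a) x)) ^ s ^ m := by
          rw [Finset.expect_comm]
          congr 1
          refine Finset.expect_congr rfl fun x _ => ?_
          rw [Finset.expect_pow]; simp
      _ ≤ 𝔼 Y : Fin s → α, (𝔼 x : Fin m → α, ∏ a, φ (Fin.cons (Y a) x)) ^ s ^ m :=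
          pow_expect_le_expect_pow (fun Y => Finset.expect_nonneg fun x _ =>
            Finset.prod_nonneg fun a _ => hφ _) _
      _ ≤ 𝔼 Y : Fin s → α, 𝔼 X : Fin m → Fin s → α, ∏ g : Fin m → Fin s,
            ∏ a, φ (Fin.cons (Y a) fun i => X i (g i)) := by
          refine Finset.expect_le_expect fun Y _ => ?_
          exact pow_expect_le_expect_prod s m (fun x => ∏ a, φ (Fin.cons (Y a) x))
            fun x => Finset.prod_nonneg fun a _ => hφ _
      _ = _ := by
          rw [expect_fin_cons]
          refine Finset.expect_congr rfl fun Y _ => Finset.expect_congr rfl fun X _ => ?_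
          rw [Finset.prod_comm, ← Fintype.prod_prod_type',
            ← (Fin.consEquiv fun _ : Fin (m + 1) => Fin s).prod_comp]
          refine Finset.prod_congr rfl fun p _ => congrArg φ (funext fun i => ?_)
          refine Fin.cases ?_ (fun j => ?_) i <;> simp

lemma expect_propInd_not_forall_le [Nonempty α] (Q : α → Prop) : ∀ m : ℕ,
    𝔼 X : Fin m → α, propInd (¬ ∀ i, Q (X i)) ≤ m * 𝔼 y, propInd (¬ Q y)
  | 0 => by simp [propInd]
  | m + 1 => by
    calc 𝔼 X : Fin (m + 1) → α, propInd (¬ ∀ i, Q (X i))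
        ≤ 𝔼 y : α, 𝔼 X : Fin m → α, (propInd (¬ Q y) + propInd (¬ ∀ i, Q (X i))) := by
          rw [expect_fin_cons]
          refine Finset.expect_le_expect fun y _ => Finset.expect_le_expect fun X _ => ?_
          refine propInd_le_add fun h => ?_
          rw [Fin.forall_fin_succ] at h
          simp only [Fin.cons_zero, Fin.cons_succ] at h
          tauto
      _ = 𝔼 y, propInd (¬ Q y) + 𝔼 X : Fin m → α, propInd (¬ ∀ i, Q (X i)) := by
          simp only [Finset.expect_add_distrib, Fintype.expect_const]
      _ ≤ (m + 1 : ℕ) * 𝔼 y, propInd (¬ Q y) := by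
          have := expect_propInd_not_forall_le Q m
          push_cast
          linarith

lemma expect_propInd_not_injective_cons_le [Nonempty α] (v : α) : ∀ r : ℕ,
    𝔼 x : Fin r → α, propInd (¬ Injective (Fin.cons v x : Fin (r + 1) → α)) ≤
      (r + 1) ^ 2 / Fintype.card α
  | 0 => by
    have : ∀ x : Fin 0 → α, Injective (Fin.cons v x : Fin 1 → α) := fun x => by
      simp [injective_of_subsingleton]
    simp only [this, not_true, propInd_of_not not_false, Fintype.expect_const]
    positivity
  | r + 1 => by
    classical
    have hy : ∀ x : Fin r → α, 𝔼 y, propInd (y ∈ insert v (univ.image x)) ≤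
        ((r + 1 : ℕ) : ℝ) / Fintype.card α := by
      intro x
      rw [expect_propInd]
      gcongr
      refine (card_le_card (t := insert v (univ.image x)) fun y hy => by simpa using hy).trans ((card_insert_le _ _).trans ?_)
      have := card_image_le (s := univ) (f := x)
      simp only [card_univ, Fintype.card_fin] at this
      omega
    calc 𝔼 x : Fin (r + 1) → α, propInd (¬ Injective (Fin.cons v x : Fin (r + 1 + 1) → α))
        ≤ 𝔼 x : Fin r → α, 𝔼 y : α, (propInd (¬ Injective (Fin.cons v x : Fin (r + 1) → α)) +
            propInd (y ∈ insert v (univ.image x))) := by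
          rw [expect_fin_cons, Finset.expect_comm]
          refine Finset.expect_le_expect fun x _ => Finset.expect_le_expect fun y _ => ?_
          refine propInd_le_add fun h => ?_
          by_contra! hc
          refine h ?_
          obtain ⟨h1, h2⟩ := hc
          simp only [Fin.cons_injective_iff, Fin.range_cons, mem_insert, mem_image, mem_univ,
            true_and, Set.mem_insert_iff, Set.mem_range, not_or] at *
          exact ⟨⟨fun h => h2.1 h.symm, h1.1⟩, h2.2, h1.2⟩
      _ ≤ (r + 1) ^ 2 / Fintype.card α + ((r + 1 : ℕ) : ℝ) / Fintype.card α := by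
          simp only [Finset.expect_add_distrib, Fintype.expect_const]
          exact add_le_add (expect_propInd_not_injective_cons_le v r)
            (Finset.expect_le univ_nonempty fun x _ => hy x)
      _ ≤ _ := by
          rw [← add_div]
          gcongr
          push_cast
          nlinarith

end Expect

section Blowup

variable {V : Type} [DecidableEq V]

lemma injective_of_card_image {α : Type*} {r : ℕ} [DecidableEq α] {y : Fin r → α}
    (h : (univ.image y).card = r) : Injective y :=
  by
  rw [← Set.injOn_univ, ← Finset.coe_univ]
  exact Finset.card_image_iff.1 (by simpa using h)

lemma image_fin_cons {r : ℕ} (u : V) (y : Fin r → V) :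
    univ.image (Fin.cons u y : Fin (r + 1) → V) = insert u (univ.image y) := by
  ext z
  simp [Fin.exists_fin_succ, eq_comm]

/-- The ordered tuple `(u, w, x)` spans an edge. -/
def ConsEdge (E : Finset (Finset V)) {m : ℕ} (u w : V) (x : Fin m → V) : Prop :=
  univ.image (Fin.cons u (Fin.cons w x : Fin (m + 1) → V) : Fin (m + 2) → V) ∈ E

/-- Classes all of whose transversals are edges are pairwise disjoint. -/
lemma injective_uncurry_of_transversals {k s : ℕ} {E : Finset (Finset V)} (hE : IsKGraph k E)
    {F : Fin k → Fin s → V} (hF : ∀ i, Injective (F i))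
    (h : ∀ g : Fin k → Fin s, (univ.image fun i => F i (g i)) ∈ E) :
    Injective fun q : Fin k × Fin s => F q.1 q.2 := by
  rintro ⟨i, a⟩ ⟨j, b⟩ hab
  by_cases hij : i = j
  · subst hij
    exact congrArg _ (hF i hab)
  · have := injective_of_card_image (hE _ (h fun l => if l = i then a else b))
    exact absurd (this (a₁ := i) (a₂ := j) (by simpa [Ne.symm hij] using hab)) hij

variable [Fintype V]

lemma degS_le_card_filter_insert {E : Finset (Finset V)} {r : ℕ} (hE : IsKGraph (r + 1) E)
    {S : Finset V} (hS : S.card = r) : degS E S ≤ #{u | insert u S ∈ E} := by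
  refine (card_le_card (t := ({u | insert u S ∈ E} : Finset V).image (insert · S))
    fun e he => ?_).trans card_image_le
  rw [mem_filter] at he
  obtain ⟨heE, hSe⟩ := he
  obtain ⟨u, hu⟩ : ∃ u, e \ S = {u} := by
    rw [← card_eq_one, card_sdiff_of_subset hSe, hE e heE, hS, Nat.add_sub_cancel_left]
  have : insert u S = e := by
    rw [insert_eq, ← hu, sdiff_union_of_subset hSe]
  exact mem_image.2 ⟨u, by simpa [this] using heE, this⟩

lemma le_expect_propInd_insert [Nonempty V] {E : Finset (Finset V)} {r : ℕ} {p : ℝ}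
    (hE : IsKGraph (r + 1) E)
    (hp : ∀ S : Finset V, S.card = r → p * Fintype.card V ≤ degS E S)
    {S : Finset V} (hS : S.card = r) : p ≤ 𝔼 u, propInd (insert u S ∈ E) := by
  have h : p * Fintype.card V ≤ (#{u | insert u S ∈ E} : ℝ) :=
    (hp S hS).trans (mod_cast degS_le_card_filter_insert hE hS)
  rw [expect_propInd, le_div_iff₀ (by simp [Fintype.card_pos])]
  exact h

/-- Density of stars: tuples `(U, w, x)` such that `(w, x)` together with `v`, and with each
entry of `U`, spans an edge. -/
lemma le_expect_consEdge [Nonempty V] {E : Finset (Finset V)} {m : ℕ} {p : ℝ} (t : ℕ)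
    (hE : IsKGraph (m + 2) E) (hp0 : 0 ≤ p)
    (hp : ∀ S : Finset V, S.card = m + 1 → p * Fintype.card V ≤ degS E S)
    (hn : 2 * (m + 1) ^ 2 ≤ Fintype.card V) (v : V) :
    p ^ (t + 1) / 2 ≤ 𝔼 U : Fin t → V, 𝔼 w, 𝔼 x : Fin m → V,
      propInd (∀ a, ConsEdge E ((Fin.cons v U : Fin (t + 1) → V) a) w x) := by
  have hcard : (0 : ℝ) < Fintype.card V := by simp [Fintype.card_pos]
  have key : ∀ w (x : Fin m → V), propInd (ConsEdge E v w x) * p ^ t ≤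
      𝔼 U : Fin t → V, propInd (∀ a, ConsEdge E ((Fin.cons v U : Fin (t + 1) → V) a) w x) := by
    intro w x
    have h1 : 𝔼 U : Fin t → V,
        propInd (∀ a, ConsEdge E ((Fin.cons v U : Fin (t + 1) → V) a) w x) =
        propInd (ConsEdge E v w x) * (𝔼 u, propInd (ConsEdge E u w x)) ^ t := by
      simp_rw [← prod_propInd, Fin.prod_univ_succ, Fin.cons_zero, Fin.cons_succ]
      rw [← Finset.mul_expect, Finset.expect_pow]
      simp
    rw [h1]
    by_cases h : ConsEdge E v w x
    · refine mul_le_mul_of_nonneg_left (pow_le_pow_left₀ hp0 ?_ t) (propInd_nonneg _)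
      have hinj : Injective (Fin.cons w x : Fin (m + 1) → V) :=
        (Fin.cons_injective_iff.1 (injective_of_card_image (hE _ h))).2
      simp_rw [ConsEdge, fun u => image_fin_cons u (Fin.cons w x : Fin (m + 1) → V)]
      exact le_expect_propInd_insert hE hp (by simp [card_image_of_injective _ hinj])
    · simp [propInd_of_not h]
  have hlink : p / 2 ≤ 𝔼 x : Fin m → V, 𝔼 w, propInd (ConsEdge E v w x) := by
    have hx : ∀ x : Fin m → V,
        p * (1 - propInd (¬ Injective (Fin.cons v x : Fin (m + 1) → V))) ≤
          𝔼 w, propInd (ConsEdge E v w x) := by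
      intro x
      by_cases h : Injective (Fin.cons v x : Fin (m + 1) → V)
      · rw [propInd_of_not (not_not.2 h), sub_zero, mul_one]
        have h2 : ∀ w, ConsEdge E v w x ↔
            insert w (univ.image (Fin.cons v x : Fin (m + 1) → V)) ∈ E := fun w => by
          rw [ConsEdge, image_fin_cons, image_fin_cons, image_fin_cons, insert_comm]
        simp_rw [h2]
        exact le_expect_propInd_insert hE hp (by simp [card_image_of_injective _ h])
      · rw [propInd_of h, sub_self, mul_zero]
        exact Finset.expect_nonneg fun _ _ => propInd_nonneg _
    refine le_trans ?_ (Finset.expect_le_expect fun x _ => hx x)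
    rw [← Finset.mul_expect, Finset.expect_sub_distrib, Fintype.expect_const, div_eq_mul_inv]
    refine mul_le_mul_of_nonneg_left ?_ hp0
    have h3 := expect_propInd_not_injective_cons_le v m
    have h4 : ((m : ℝ) + 1) ^ 2 / Fintype.card V ≤ 1 / 2 := by
      rw [div_le_div_iff₀ hcard two_pos]
      have : ((2 * (m + 1) ^ 2 : ℕ) : ℝ) ≤ Fintype.card V := mod_cast hn
      push_cast at this
      linarith
    linarith
  calc p ^ (t + 1) / 2 = p / 2 * p ^ t := by ring
    _ ≤ (𝔼 x : Fin m → V, 𝔼 w, propInd (ConsEdge E v w x)) * p ^ t := by gcongr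
    _ = 𝔼 w, 𝔼 x : Fin m → V, propInd (ConsEdge E v w x) * p ^ t := by
        rw [Finset.expect_comm]; simp_rw [Finset.expect_mul]
    _ ≤ 𝔼 w, 𝔼 x : Fin m → V, 𝔼 U : Fin t → V,
          propInd (∀ a, ConsEdge E ((Fin.cons v U : Fin (t + 1) → V) a) w x) :=
        Finset.expect_le_expect fun w _ => Finset.expect_le_expect fun x _ => key w x
    _ = _ := by
        rw [Finset.expect_comm univ univ fun (U : Fin t → V) w => _]
        refine Finset.expect_congr rfl fun w _ => ?_
        rw [Finset.expect_comm]

/-- Large codegree density yields the vertex classes of a complete partite subgraph, the first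
of which contains `v`. -/
lemma exists_classes [Nonempty V] {E : Finset (Finset V)} {m t : ℕ} {p : ℝ}
    (hE : IsKGraph (m + 2) E) (hp0 : 0 ≤ p)
    (hp : ∀ S : Finset V, S.card = m + 1 → p * Fintype.card V ≤ degS E S)
    (hn : 2 * (m + 1) ^ 2 ≤ Fintype.card V)
    (hbig : (((t : ℝ) + 1) ^ 2 + m * (t + 2) ^ 2 + (t + 1)) / Fintype.card V <
      (p ^ (t + 1) / 2) ^ (t + 1) ^ m) (v : V) :
    ∃ (U : Fin t → V) (W : Fin (t + 1) → V) (X : Fin m → Fin (t + 1) → V),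
      Injective (Fin.cons v U : Fin (t + 1) → V) ∧ Injective W ∧ (∀ i, Injective (X i)) ∧
      ∀ a b (g : Fin m → Fin (t + 1)),
        ConsEdge E ((Fin.cons v U : Fin (t + 1) → V) a) (W b) fun i => X i (g i) := by
  classical
  let Complete (U : Fin t → V) (w : V) (X : Fin m → Fin (t + 1) → V) : Prop :=
    ∀ (g : Fin m → Fin (t + 1)) a,
      ConsEdge E ((Fin.cons v U : Fin (t + 1) → V) a) w fun i => X i (g i)
  have hcount : (p ^ (t + 1) / 2) ^ (t + 1) ^ m ≤
      𝔼 U, 𝔼 X, 𝔼 w, propInd (Complete U w X) := by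
    calc (p ^ (t + 1) / 2) ^ (t + 1) ^ m
        ≤ (𝔼 U : Fin t → V, 𝔼 w, 𝔼 x : Fin m → V, propInd
            (∀ a, ConsEdge E ((Fin.cons v U : Fin (t + 1) → V) a) w x)) ^ (t + 1) ^ m := by
          gcongr
          exact le_expect_consEdge t hE hp0 hp hn v
      _ ≤ 𝔼 U : Fin t → V, (𝔼 w, 𝔼 x : Fin m → V, propInd
            (∀ a, ConsEdge E ((Fin.cons v U : Fin (t + 1) → V) a) w x)) ^ (t + 1) ^ m :=
          pow_expect_le_expect_pow (fun U => Finset.expect_nonneg fun w _ =>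
            Finset.expect_nonneg fun x _ => propInd_nonneg _) _
      _ ≤ 𝔼 U : Fin t → V, 𝔼 w, (𝔼 x : Fin m → V, propInd
            (∀ a, ConsEdge E ((Fin.cons v U : Fin (t + 1) → V) a) w x)) ^ (t + 1) ^ m :=
          Finset.expect_le_expect fun U _ => pow_expect_le_expect_pow
            (fun w => Finset.expect_nonneg fun x _ => propInd_nonneg _) _
      _ ≤ 𝔼 U, 𝔼 w, 𝔼 X, propInd (Complete U w X) := by
          refine Finset.expect_le_expect fun U _ => Finset.expect_le_expect fun w _ => ?_
          refine (pow_expect_le_expect_prod (α := V) (t + 1) m _ fun x => propInd_nonneg _).trans ?_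
          simp_rw [prod_propInd]
          exact le_rfl
      _ = _ := Finset.expect_congr rfl fun U _ => Finset.expect_comm _ _ _
  obtain ⟨U, X, hUX⟩ : ∃ U X, propInd (¬ Injective (Fin.cons v U : Fin (t + 1) → V)) +
      propInd (¬ ∀ i, Injective (X i)) + ((t : ℝ) + 1) / Fintype.card V <
        𝔼 w, propInd (Complete U w X) := by
    by_contra hcon
    have hle := fun U X => not_lt.1 fun h => hcon ⟨U, X, h⟩
    refine hbig.not_ge (hcount.trans ((Finset.expect_le_expect fun U _ =>
      Finset.expect_le_expect fun X _ => hle U X).trans ?_))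
    simp only [Finset.expect_add_distrib, Fintype.expect_const, add_div]
    gcongr
    · exact expect_propInd_not_injective_cons_le v t
    · refine (expect_propInd_not_forall_le (α := Fin (t + 1) → V) Injective m).trans ?_
      rw [mul_div_assoc]
      gcongr
      calc 𝔼 y : Fin (t + 1) → V, propInd (¬ Injective y)
          ≤ 𝔼 y : Fin (t + 1) → V, propInd (¬ Injective (Fin.cons v y : Fin (t + 1 + 1) → V)) :=
            Finset.expect_le_expect fun y _ => propInd_mono fun h hinj =>
              h (Fin.cons_injective_iff.1 hinj).2
        _ ≤ _ := by
            refine (expect_propInd_not_injective_cons_le v (t + 1)).trans_eq ?_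
            push_cast
            ring
  have hw1 : 𝔼 w, propInd (Complete U w X) ≤ 1 :=
    Finset.expect_le (univ_nonempty (α := V)) fun w _ => propInd_le_one _
  have hpos : 0 < ((t : ℝ) + 1) / Fintype.card V := by
    have : (0 : ℝ) < Fintype.card V := by simp [Fintype.card_pos]
    positivity
  have hU : Injective (Fin.cons v U : Fin (t + 1) → V) := by
    by_contra h
    rw [propInd_of h] at hUX
    linarith [propInd_nonneg (¬ ∀ i, Injective (X i))]
  have hX : ∀ i, Injective (X i) := by
    by_contra h
    rw [propInd_of h] at hUX
    linarith [propInd_nonneg (¬ Injective (Fin.cons v U : Fin (t + 1) → V))]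
  rw [propInd_of_not (not_not.2 hU), propInd_of_not (not_not.2 hX), zero_add, zero_add,
    expect_propInd, div_lt_div_iff_of_pos_right (by simp [Fintype.card_pos])] at hUX
  obtain ⟨W⟩ : Nonempty (Fin (t + 1) ↪ {w // Complete U w X}) := by
    rw [Function.Embedding.nonempty_iff_card_le, Fintype.card_fin, Fintype.card_subtype]
    exact_mod_cast hUX.le
  exact ⟨U, fun b => W b, X, hU, Subtype.val_injective.comp W.injective, hX,
    fun a b g => (W b).2 g a⟩

end Blowup

/-- for all `k ≥ 3`, `s ≥ 1` there are `c > 0` and `n₀` such that every `k`-graph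
on `n ≥ n₀` vertices with minimum codegree at least `c·n^(1 - 1/s^(k-1))` has a
`K^k(s)`-covering. -/
theorem Kks_covering (k s : ℕ) (hk : 3 ≤ k) (hs : 1 ≤ s) :
    ∃ (c : ℝ) (n₀ : ℕ), 0 < c ∧
      ∀ (V : Type) [Fintype V] [DecidableEq V] (E : Finset (Finset V)),
        IsKGraph k E → n₀ ≤ Fintype.card V →
        (∀ S : Finset V, S.card = k - 1 →
          c * (Fintype.card V : ℝ) ^ ((1 : ℝ) - 1 / (s : ℝ) ^ (k - 1)) ≤ (degS E S : ℝ)) →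
        ∀ v : V, ∃ f : Fin k × Fin s → V, Function.Injective f ∧ (∃ p, f p = v) ∧
          ∀ g : Fin k → Fin s, (Finset.univ.image fun i => f (i, g i)) ∈ E := by
  obtain ⟨m, rfl⟩ : ∃ m, k = m + 2 := ⟨k - 2, by omega⟩
  obtain ⟨t, rfl⟩ : ∃ t, s = t + 1 := ⟨s - 1, by omega⟩
  simp only [show m + 2 - 1 = m + 1 by omega, Nat.cast_add, Nat.cast_one]
  set B : ℝ := ((t : ℝ) + 1) ^ 2 + m * (t + 2) ^ 2 + (t + 1)
  set c : ℝ := 2 ^ (t + 1) ^ m * (B + 1) with hc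
  have hB0 : 0 ≤ B := by positivity
  have hc1 : 1 ≤ c := one_le_mul_of_one_le_of_one_le (one_le_pow₀ one_le_two) (by linarith)
  refine ⟨c, 2 * (m + 1) ^ 2, by linarith, fun V _ _ E hE hn hdeg v => ?_⟩
  have : Nonempty V := ⟨v⟩
  have hn0 : (0 : ℝ) < Fintype.card V := by exact_mod_cast Fintype.card_pos
  set n : ℝ := ((Fintype.card V : ℕ) : ℝ)
  set p : ℝ := c * n ^ (-(1 / ((t : ℝ) + 1) ^ (m + 1))) with hpd
  have hp0 : 0 ≤ p := by positivity
  have hpn : p * n = c * n ^ (1 - 1 / ((t : ℝ) + 1) ^ (m + 1)) := by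
    rw [hpd, mul_assoc, sub_eq_neg_add, Real.rpow_add_one hn0.ne']
  have hppow : p ^ (t + 1) ^ (m + 1) = c ^ (t + 1) ^ (m + 1) / n := by
    have hexp : -(1 / ((t : ℝ) + 1) ^ (m + 1)) * ((t + 1) ^ (m + 1) : ℕ) = -1 := by
      push_cast
      field_simp
    rw [hpd, mul_pow, ← Real.rpow_mul_natCast hn0.le, hexp, Real.rpow_neg_one, div_eq_mul_inv]
  have hbig : B / n < (p ^ (t + 1) / 2) ^ (t + 1) ^ m := by
    rw [div_pow, ← pow_mul, ← pow_succ', hppow, div_div, mul_comm n, ← div_div]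
    gcongr
    rw [lt_div_iff₀ (by positivity)]
    calc B * 2 ^ (t + 1) ^ m < c := by
          rw [hc, mul_comm]
          gcongr
          linarith
      _ ≤ c ^ (t + 1) ^ (m + 1) := le_self_pow₀ hc1 (by positivity)
  obtain ⟨U, W, X, hU, hW, hX, hUWX⟩ :=
    exists_classes hE hp0 (fun S hS => hpn.trans_le (hdeg S hS)) hn hbig v
  let F : Fin (m + 2) → Fin (t + 1) → V := Fin.cons (Fin.cons v U) (Fin.cons W X)
  have hF : ∀ i, Function.Injective (F i) := by
    intro i
    refine Fin.cases hU (fun i => ?_) i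
    exact Fin.cases hW hX i
  have hedge : ∀ g : Fin (m + 2) → Fin (t + 1), (univ.image fun i => F i (g i)) ∈ E := by
    intro g
    have htuple : (fun i => F i (g i)) = Fin.cons ((Fin.cons v U : Fin (t + 1) → V) (g 0))
        (Fin.cons (W (g 1)) fun i => X i (g i.succ.succ) : Fin (m + 1) → V) := by
      funext i
      refine Fin.cases rfl (fun i => ?_) i
      exact Fin.cases rfl (fun _ => rfl) i
    rw [htuple]
    exact hUWX (g 0) (g 1) fun i => g i.succ.succ
  exact ⟨fun q => F q.1 q.2, injective_uncurry_of_transversals hE hF hedge, ⟨(0, 0), rfl⟩, hedge⟩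
end

section
/- For every integer k ≥ 3 and every γ > 0 there exist n₀ and t₀ such that the following holds for all n ≥ n₀. Let H be a k-graph on n vertices with δ_{k−1}(H) ≥ (1/2 + γ)n containing a complete (k,k)-graph K with vertex classes V₁,…,V_k. Let S ⊆ V(H) be a set of vertices such that |V(K) ∪ S| ≤ γn/2 and |V_i ∖ S| ≥ t₀ for all 1 ≤ i ≤ k. Then for every graph G on [k], K has a G-gadget avoiding S. -/
set_option autoImplicit false

open Finset

/-- Bonferroni's inequality for sets whose pairwise intersections have size at most `d`. -/
lemma card_biUnion_ge {ι W : Type} [DecidableEq ι] [DecidableEq W] (I : Finset ι)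
    (M : ι → Finset W) (a d : ℝ) (hM : ∀ i ∈ I, a ≤ ((M i).card : ℝ))
    (hd : ∀ i ∈ I, ∀ j ∈ I, i ≠ j → ((M i ∩ M j).card : ℝ) ≤ d) (hd0 : 0 ≤ d) :
    (I.card : ℝ) * a - (I.card : ℝ) ^ 2 * d ≤ ((I.biUnion M).card : ℝ) := by
  induction I using Finset.induction_on with
  | empty => simp
  | insert x I hx ih =>
    have ih' := ih (fun i hi => hM i (mem_insert_of_mem hi))
      (fun i hi j hj => hd i (mem_insert_of_mem hi) j (mem_insert_of_mem hj))
    have h1 : ((M x ∩ I.biUnion M).card : ℝ) ≤ I.card * d := by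
      rw [inter_biUnion]
      calc (((I.biUnion fun i => M x ∩ M i).card : ℕ) : ℝ)
          ≤ ((∑ i ∈ I, (M x ∩ M i).card : ℕ) : ℝ) := by exact_mod_cast card_biUnion_le
        _ = ∑ i ∈ I, ((M x ∩ M i).card : ℝ) := by push_cast; rfl
        _ ≤ ∑ _i ∈ I, d := sum_le_sum fun i hi =>
            hd x (mem_insert_self _ _) i (mem_insert_of_mem hi) (by rintro rfl; exact hx hi)
        _ = I.card * d := by simp
    have h2 : ((M x ∪ I.biUnion M).card : ℝ) + (M x ∩ I.biUnion M).card
        = (M x).card + (I.biUnion M).card := by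
      exact_mod_cast card_union_add_card_inter _ _
    have h3 := hM x (mem_insert_self _ _)
    rw [biUnion_insert, card_insert_of_notMem hx]
    push_cast
    have : (0 : ℝ) ≤ I.card := by positivity
    nlinarith

/-- Among sufficiently many dense subsets of a finite set, some two have a dense intersection. -/
lemma exists_dense_inter (c : ℝ) (hc : 0 < c) :
    ∃ q : ℕ, ∃ c' : ℝ, 0 < c' ∧ ∀ (ι W : Type) [DecidableEq ι] [Fintype W] [DecidableEq W]
      [Nonempty W] (I : Finset ι) (M : ι → Finset W), q ≤ I.card →
      (∀ i ∈ I, c * Fintype.card W ≤ ((M i).card : ℝ)) →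
      ∃ i ∈ I, ∃ j ∈ I, i ≠ j ∧ c' * Fintype.card W ≤ ((M i ∩ M j).card : ℝ) := by
  obtain ⟨q, hq⟩ := exists_nat_gt (2 / c)
  have hq0 : (0 : ℝ) < q := lt_trans (by positivity) hq
  refine ⟨q, 1 / (q : ℝ) ^ 2, by positivity, ?_⟩
  intro ι W _ _ _ _ I M hI hM
  obtain ⟨J, hJI, hJ⟩ := exists_subset_card_eq hI
  by_contra! hcon
  have hn : (0 : ℝ) < Fintype.card W := by exact_mod_cast Fintype.card_pos
  have h := card_biUnion_ge J M (c * Fintype.card W) (1 / (q : ℝ) ^ 2 * Fintype.card W)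
    (fun i hi => hM i (hJI hi))
    (fun i hi j hj hij => (hcon i (hJI hi) j (hJI hj) hij).le) (by positivity)
  have hu : ((J.biUnion M).card : ℝ) ≤ Fintype.card W := by exact_mod_cast card_le_univ _
  rw [hJ] at h
  have h1 : (q : ℝ) ^ 2 * (1 / (q : ℝ) ^ 2 * Fintype.card W) = Fintype.card W := by
    field_simp
  rw [div_lt_iff₀ hc] at hq
  nlinarith

/-- If every transversal of large sets `A 0, …, A (m - 1)` has a dense neighbourhood, then there are
pairs `B l ⊆ A l` such that all transversals of the pairs have a dense common neighbourhood. -/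
lemma exists_pairs (m : ℕ) : ∀ c : ℝ, 0 < c → ∃ t : ℕ, ∃ c' : ℝ, 0 < c' ∧
    ∀ (V W : Type) [DecidableEq V] [Fintype W] [DecidableEq W] [Nonempty W]
      (A : Fin m → Finset V) (N : (Fin m → V) → Finset W),
      (∀ l, t ≤ (A l).card) →
      (∀ x, (∀ l, x l ∈ A l) → c * Fintype.card W ≤ ((N x).card : ℝ)) →
      ∃ B : Fin m → Finset V, (∀ l, B l ⊆ A l ∧ (B l).card = 2) ∧
        ∃ Y : Finset W, c' * Fintype.card W ≤ (Y.card : ℝ) ∧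
          ∀ x, (∀ l, x l ∈ B l) → Y ⊆ N x := by
  induction m with
  | zero =>
    intro c hc
    refine ⟨0, c, hc, ?_⟩
    intro V W _ _ _ _ A N _ hN
    refine ⟨A, fun l => l.elim0, N Fin.elim0, hN _ fun l => l.elim0, fun x _ => ?_⟩
    rw [Subsingleton.elim x Fin.elim0]
  | succ m ih =>
    intro c hc
    obtain ⟨t, c₁, hc₁, ht⟩ := ih c hc
    obtain ⟨q, c₂, hc₂, hq⟩ := exists_dense_inter c₁ hc₁
    refine ⟨max t ((t.choose 2) ^ m * q + 1), c₂, hc₂, ?_⟩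
    intro V W _ _ _ _ A N hA hN
    have hA' : ∀ l : Fin m, ∃ A' ⊆ A l.succ, A'.card = t := fun l =>
      exists_subset_card_eq ((le_max_left _ _).trans (hA l.succ))
    choose A' hA'A hA't using hA'
    have key : ∀ a : V, a ∈ A 0 → ∃ B : Fin m → Finset V,
        (∀ l, B l ⊆ A' l ∧ (B l).card = 2) ∧
        ∃ Y : Finset W, c₁ * Fintype.card W ≤ (Y.card : ℝ) ∧
          ∀ x, (∀ l, x l ∈ B l) → Y ⊆ N (Fin.cons a x) := by
      intro a ha
      refine ht V W A' (fun x => N (Fin.cons a x)) (fun l => (hA't l).ge) ?_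
      intro x hx
      refine hN _ fun l => ?_
      refine Fin.cases ?_ (fun l => ?_) l
      · simpa using ha
      · simpa using hA'A l (hx l)
    choose! B hB Y hY hYN using key
    obtain ⟨B₀, hB₀, hfib⟩ := exists_lt_card_fiber_of_mul_lt_card_of_maps_to
      (s := A 0) (t := Fintype.piFinset fun l => (A' l).powersetCard 2) (f := B) (n := q)
      (fun a ha => by
        rw [Fintype.mem_piFinset]
        intro l
        rw [mem_powersetCard]
        exact hB a ha l)
      (by
        rw [Fintype.card_piFinset]
        simp only [card_powersetCard, hA't, prod_const, card_univ, Fintype.card_fin]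
        exact lt_of_lt_of_le (Nat.lt_succ_self _) ((le_max_right _ _).trans (hA 0)))
    obtain ⟨a, ha, b, hb, hab, hYab⟩ := hq V W _ Y hfib.le
      (fun a ha => hY a (mem_filter.1 ha).1)
    rw [mem_filter] at ha hb
    refine ⟨Fin.cons {a, b} B₀, ?_, Y a ∩ Y b, hYab, ?_⟩
    · intro l
      refine Fin.cases ?_ (fun l => ?_) l
      · simp only [Fin.cons_zero]
        refine ⟨?_, card_pair hab⟩
        intro v hv
        rw [mem_insert, mem_singleton] at hv
        rcases hv with rfl | rfl
        exacts [ha.1, hb.1]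
      · simp only [Fin.cons_succ]
        rw [← ha.2]
        exact ⟨((hB a ha.1 l).1).trans (hA'A l), (hB a ha.1 l).2⟩
    · intro x hx
      have h0 := hx 0
      have hs : ∀ l : Fin m, Fin.tail x l ∈ B₀ l := fun l => by
        simpa [Fin.tail] using hx l.succ
      rw [Fin.cons_zero, mem_insert, mem_singleton] at h0
      rw [← Fin.cons_self_tail x]
      rcases h0 with h0 | h0 <;> rw [h0]
      · exact inter_subset_left.trans (hYN a ha.1 _ (by rw [ha.2]; exact hs))
      · exact inter_subset_right.trans (hYN b hb.1 _ (by rw [hb.2]; exact hs))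

/-- The degree of `T` is at most the number of vertices extending `T` to an edge. -/
lemma degS_le_card_extensions {V : Type} [Fintype V] [DecidableEq V] {k : ℕ} (hk : 1 ≤ k)
    {E : Finset (Finset V)} (hE : IsKGraph k E) (T : Finset V) (hT : T.card = k - 1) :
    degS E T ≤ (univ.filter fun w => insert w T ∈ E).card := by
  refine le_trans (card_le_card ?_) (card_image_le (f := fun w => insert w T))
  intro e he
  rw [mem_filter] at he
  have h1 : (e \ T).card = 1 := by
    rw [card_sdiff_of_subset he.2, hE e he.1, hT]
    omega
  obtain ⟨w, hw⟩ := card_eq_one.1 h1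
  have h2 : insert w T = e := by
    rw [insert_eq, ← hw, sdiff_union_of_subset he.2]
  exact mem_image.2 ⟨w, by simp [h2, he.1], h2⟩

/-- `W` satisfies the conditions on the part `W_{ij}` of a gadget avoiding `S`. -/
def IsEdgeGadget {V : Type} [Fintype V] [DecidableEq V] (k : ℕ) (E : Finset (Finset V))
    (Vc : Fin k → Finset V) (S : Finset V) (i j : Fin k) (W : Finset V) : Prop :=
  W.card = 2 * k - 1 ∧
  (W \ univ.biUnion Vc).card = 1 ∧
  Disjoint W S ∧
  (∀ i' : Fin k, (W ∩ Vc i').card = if i' = i ∨ i' = j then 1 else 2) ∧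
  (∀ σ : Equiv.Perm (Fin k), (∃ z : Fin k, (z : ℕ) = 0 ∧ (σ z = i ∨ σ z = j)) →
    ∃ Q : List V, IsTightPath k E Q ∧ Q.toFinset = W ∧
      hasStartType k Vc Q (σ * cyc k) ∧ hasEndType k Vc Q (Equiv.swap i j * σ))

lemma IsEdgeGadget.symm {V : Type} [Fintype V] [DecidableEq V] {k : ℕ} {E : Finset (Finset V)}
    {Vc : Fin k → Finset V} {S : Finset V} {i j : Fin k} {W : Finset V}
    (h : IsEdgeGadget k E Vc S i j W) : IsEdgeGadget k E Vc S j i W := by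
  obtain ⟨h1, h2, h3, h4, h5⟩ := h
  refine ⟨h1, h2, h3, fun i' => ?_, fun σ => ?_⟩
  · rw [h4 i']
    exact if_congr or_comm rfl rfl
  · rintro ⟨z, hz, hσ⟩
    rw [Equiv.swap_comm]
    exact h5 σ ⟨z, hz, hσ.symm⟩

/-- The `p`-th vertex (`0 ≤ p ≤ 2k - 2`) of the tight path
`a_{σ(2)} ⋯ a_{σ(k)} w b_{(ij)σ(2)} ⋯ b_{(ij)σ(k)}`. -/
def gadgetPath {V : Type} {k : ℕ} [NeZero k] (a b : Fin k → V) (w : V) (i j : Fin k)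
    (σ : Equiv.Perm (Fin k)) (p : ℕ) : V :=
  if p + 1 < k then a (σ (Fin.ofNat k (p + 1)))
  else if p + 1 = k then w
  else b (Equiv.swap i j (σ (Fin.ofNat k (p + 1 - k))))

lemma finOfNat_ne_zero {k : ℕ} [NeZero k] {m : ℕ} (h0 : m ≠ 0) (h : m < k) :
    Fin.ofNat k m ≠ 0 := by
  intro h'
  have := congrArg Fin.val h'
  simp [Fin.ofNat, Nat.mod_eq_of_lt h] at this
  exact h0 this

lemma finOfNat_val {k : ℕ} [NeZero k] {m : ℕ} (h : m < k) : (Fin.ofNat k m : ℕ) = m := by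
  simp [Fin.ofNat, Nat.mod_eq_of_lt h]

lemma finOfNat_inj {k : ℕ} [NeZero k] {m n : ℕ} (hm : m < k) (hn : n < k)
    (h : Fin.ofNat k m = Fin.ofNat k n) : m = n := by
  rw [← finOfNat_val hm, ← finOfNat_val hn, h]

lemma eq_of_mem_classes {V : Type} {k : ℕ} {Vc : Fin k → Finset V}
    (hdisj : ∀ i j, i ≠ j → Disjoint (Vc i) (Vc j)) {l l' : Fin k}
    {v : V} (h : v ∈ Vc l) (h' : v ∈ Vc l') : l = l' := by
  by_contra hne
  exact disjoint_left.1 (hdisj l l' hne) h h'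

section Path

variable {V : Type} {k : ℕ} [NeZero k]
  {Vc : Fin k → Finset V} {a b : Fin k → V} {w : V} {i j : Fin k} {σ : Equiv.Perm (Fin k)}

lemma gadgetPath_ne (hdisj : ∀ i j, i ≠ j → Disjoint (Vc i) (Vc j))
    (ha : ∀ l, a l ∈ Vc l) (hb : ∀ l, b l ∈ Vc l) (hw : ∀ l, w ∉ Vc l)
    (hab : ∀ l, a l = b l → l = i ∨ l = j) (hσ : σ 0 = i) {p r : ℕ} (hpr : p < r)
    (hr : r < 2 * k - 1) : gadgetPath a b w i j σ p ≠ gadgetPath a b w i j σ r := by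
  have hE := fun {l l' : Fin k} {v : V} => eq_of_mem_classes hdisj (l := l) (l' := l') (v := v)
  unfold gadgetPath
  intro h
  split_ifs at h with h1 h2 h3 h4 h5 h6 <;> try omega
  · have := hE (ha _) (h ▸ ha _)
    have := finOfNat_inj h2 h1 (σ.injective this)
    omega
  · exact hw _ (h ▸ ha _)
  · have hl := hE (ha _) (h ▸ hb _)
    rw [← hl] at h
    have h8 := finOfNat_ne_zero (Nat.succ_ne_zero p) h1
    have h9 := finOfNat_ne_zero (k := k) (m := r + 1 - k) (by omega) (by omega)
    rcases hab _ h with hi | hj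
    · rw [← hσ] at hi
      exact h8 (σ.injective hi)
    · rw [hj] at hl
      have h10 := congrArg (Equiv.swap i j) hl
      rw [Equiv.swap_apply_right, Equiv.swap_apply_self, ← hσ] at h10
      exact h9 (σ.injective h10).symm
  · exact hw _ (h ▸ hb _)
  · have := hE (hb _) (h ▸ hb _)
    have := finOfNat_inj (by omega) (by omega) (σ.injective ((Equiv.swap i j).injective this))
    omega

/-- The vertices `gadgetPath a b w i j σ p` form a spanning tight path of the required types. -/
lemma exists_tightPath [DecidableEq V] {E : Finset (Finset V)} {U : Finset V}
    (hdisj : ∀ i j, i ≠ j → Disjoint (Vc i) (Vc j))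
    (ha : ∀ l, a l ∈ Vc l) (hb : ∀ l, b l ∈ Vc l) (hw : ∀ l, w ∉ Vc l)
    (hab : ∀ l, a l = b l → l = i ∨ l = j) (hσ : σ 0 = i)
    (hE : ∀ x : Fin k → V, (∀ l, x l = a l ∨ x l = b l) → ∀ c, c = i ∨ c = j →
      insert w ((univ.erase c).image x) ∈ E)
    (hwU : w ∈ U) (haU : ∀ l, a l ∈ U) (hbU : ∀ l, b l ∈ U) (hU : U.card = 2 * k - 1) :
    ∃ Q : List V, IsTightPath k E Q ∧ Q.toFinset = U ∧
      hasStartType k Vc Q (σ * cyc k) ∧ hasEndType k Vc Q (Equiv.swap i j * σ) := by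
  have hk : 0 < k := Nat.pos_of_ne_zero (NeZero.ne k)
  set q := gadgetPath a b w i j σ with hq
  set Q := (List.range (2 * k - 1)).map q with hQ
  have hlen : Q.length = 2 * k - 1 := by simp [hQ]
  have hnd : Q.Nodup := by
    refine List.Nodup.map_on ?_ List.nodup_range
    intro p hp r hr h
    rw [List.mem_range] at hp hr
    by_contra hne
    rcases lt_or_gt_of_ne hne with hlt | hlt
    · exact gadgetPath_ne hdisj ha hb hw hab hσ hlt hr h
    · exact gadgetPath_ne hdisj ha hb hw hab hσ hlt hp h.symm
  refine ⟨Q, ⟨hnd, ?_⟩, ?_, ⟨by omega, ?_⟩, ⟨by omega, ?_⟩⟩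
  · intro s hs
    rw [hlen] at hs
    obtain ⟨ρ, hρ0, hρ⟩ : ∃ ρ : Equiv.Perm (Fin k), (ρ 0 = i ∨ ρ 0 = j) ∧
        ∀ m : Fin k, m ≠ 0 → (s < (m : ℕ) → ρ m = σ m) ∧
          ((m : ℕ) ≤ s → ρ m = Equiv.swap i j (σ m)) := by
      have hfix : ∀ m : Fin k, m ≠ 0 → m ≠ σ.symm j → Equiv.swap i j (σ m) = σ m := by
        intro m h0 hj
        refine Equiv.swap_apply_of_ne_of_ne ?_ ?_
        · rw [← hσ]
          exact fun h => h0 (σ.injective h)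
        · rintro rfl
          simp at hj
      rcases lt_or_ge s (σ.symm j : ℕ) with hsj | hsj
      · refine ⟨σ, Or.inl hσ, fun m hm => ⟨fun _ => rfl, fun hms => (hfix m hm ?_).symm⟩⟩
        rintro rfl
        omega
      · refine ⟨σ.trans (Equiv.swap i j), Or.inr ?_, fun m hm => ⟨fun hms => ?_, fun _ => rfl⟩⟩
        · simp [hσ]
        · refine hfix m hm ?_
          rintro rfl
          omega
    set x : Fin k → V := fun l => if s < (ρ.symm l : ℕ) then a l else b l with hx
    have hmem := hE x (fun l => by simp only [hx]; split_ifs <;> simp) (ρ 0) hρ0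
    have hsub : ((Q.drop s).take k).toFinset ⊆ insert w ((univ.erase (ρ 0)).image x) := by
      intro v hv
      rw [List.mem_toFinset, List.mem_iff_getElem] at hv
      obtain ⟨p, hp, rfl⟩ := hv
      have hp' : p < k ∧ p < 2 * k - 1 - s := by
        rw [List.length_take, List.length_drop, hlen] at hp
        omega
      have hval : ((Q.drop s).take k)[p] = q (s + p) := by simp [hQ]
      rw [hval, hq]
      unfold gadgetPath
      have hin : ∀ m : ℕ, m ≠ 0 → m < k →
          x (ρ (Fin.ofNat k m)) ∈ insert w ((univ.erase (ρ 0)).image x) := by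
        intro m h0 hm
        refine mem_insert_of_mem (mem_image_of_mem x (mem_erase.2 ⟨?_, mem_univ _⟩))
        exact fun h => finOfNat_ne_zero h0 hm (ρ.injective h)
      split_ifs with h1 h2
      · have h3 := hin (s + p + 1) (by omega) h1
        have h4 := (hρ _ (finOfNat_ne_zero (Nat.succ_ne_zero (s + p)) h1)).1
          (by rw [finOfNat_val h1]; omega)
        have h5 : x (ρ (Fin.ofNat k (s + p + 1))) = a (ρ (Fin.ofNat k (s + p + 1))) := by
          simp only [hx]
          rw [Equiv.symm_apply_apply, finOfNat_val h1, if_pos (by omega)]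
        rwa [h5, h4] at h3
      · exact mem_insert_self _ _
      · have hm : s + p + 1 - k < k := by omega
        have h3 := hin (s + p + 1 - k) (by omega) hm
        have h4 := (hρ _ (finOfNat_ne_zero (by omega) hm)).2
          (by rw [finOfNat_val hm]; omega)
        have h5 : x (ρ (Fin.ofNat k (s + p + 1 - k))) = b (ρ (Fin.ofNat k (s + p + 1 - k))) := by
          simp only [hx]
          rw [Equiv.symm_apply_apply, finOfNat_val hm, if_neg (by omega)]
        rwa [h5, h4] at h3
    rw [eq_of_subset_of_card_le hsub]
    · exact hmem
    · have h1 : ((Q.drop s).take k).toFinset.card = k := by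
        rw [List.toFinset_card_of_nodup, List.length_take, List.length_drop, hlen]
        · omega
        · exact (hnd.sublist (List.drop_sublist _ _)).sublist (List.take_sublist _ _)
      rw [h1]
      refine (card_insert_le _ _).trans ?_
      have h2 : ((univ.erase (ρ 0)).image x).card ≤ k - 1 := by
        refine card_image_le.trans ?_
        rw [card_erase_of_mem (mem_univ _), card_univ, Fintype.card_fin]
      omega
  · refine eq_of_subset_of_card_le ?_ ?_
    · intro v hv
      rw [List.mem_toFinset, hQ, List.mem_map] at hv
      obtain ⟨p, -, rfl⟩ := hv
      rw [hq]
      unfold gadgetPath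
      split_ifs
      exacts [haU _, hwU, hbU _]
    · rw [List.toFinset_card_of_nodup hnd, hU, hlen]
  · intro l hl v hv
    have hv' : v = q l := by
      simpa [hQ, List.getElem?_range, show (l : ℕ) < 2 * k - 1 by omega, eq_comm] using hv
    rw [hv', hq]
    unfold gadgetPath
    rw [if_pos hl]
    have h1 : cyc k l = Fin.ofNat k (l + 1) := by
      obtain ⟨n, rfl⟩ : ∃ n, k = n + 1 := ⟨k - 1, by omega⟩
      apply Fin.ext
      rw [finOfNat_val hl, cyc, coe_finRotate_of_ne_last]
      intro h
      rw [h] at hl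
      simp at hl
    rw [Equiv.Perm.mul_apply, h1]
    exact ha _
  · intro l hl v hv
    have hv' : v = q (Q.length + l - k) := by
      have : Q.length + (l : ℕ) - k < 2 * k - 1 := by omega
      rw [hQ, List.getElem?_map, ← hQ, List.getElem?_range this] at hv
      simpa [eq_comm] using hv
    rw [hv', hq]
    unfold gadgetPath
    rw [if_neg (by omega), if_neg (by omega)]
    have h1 : Fin.ofNat k (Q.length + l - k + 1 - k) = l := by
      have h2 : Q.length + l - k + 1 - k = l := by omega
      rw [h2]
      exact Fin.ext (finOfNat_val l.2)
    rw [h1, Equiv.Perm.mul_apply]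
    exact hb _

end Path

/-- A vertex `w` completing all the transversals of pairs in the classes that miss the class `i`
or the class `j` yields the part of a gadget belonging to the edge `ij`. -/
lemma exists_isEdgeGadget_of_pairs {V : Type} [Fintype V] [DecidableEq V] {k : ℕ} (hk : 3 ≤ k)
    {E : Finset (Finset V)} {Vc : Fin k → Finset V}
    (hdisj : ∀ i j, i ≠ j → Disjoint (Vc i) (Vc j)) {S : Finset V} {i j : Fin k} (hij : i ≠ j)
    {B : Fin k → Finset V} (hB : ∀ l, B l ⊆ Vc l \ S) (hB2 : ∀ l, (B l).card = 2) {w : V}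
    (hw : w ∉ univ.biUnion Vc ∪ S)
    (hE : ∀ x : Fin k → V, (∀ l, x l ∈ B l) → ∀ c, c = i ∨ c = j →
      insert w ((univ.erase c).image x) ∈ E) :
    ∃ W, IsEdgeGadget k E Vc S i j W := by
  have hk0 : NeZero k := ⟨by omega⟩
  choose a a' haa' hBa using fun l => card_eq_two.1 (hB2 l)
  set b : Fin k → V := fun l => if l = i ∨ l = j then a l else a' l with hbdef
  have haB : ∀ l, a l ∈ B l := fun l => by simp [hBa]
  have hbB : ∀ l, b l ∈ B l := fun l => by
    simp only [hbdef, hBa]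
    split_ifs <;> simp
  have ha : ∀ l, a l ∈ Vc l := fun l => (mem_sdiff.1 (hB l (haB l))).1
  have hb : ∀ l, b l ∈ Vc l := fun l => (mem_sdiff.1 (hB l (hbB l))).1
  rw [mem_union, mem_biUnion] at hw
  push Not at hw
  have hwV : ∀ l, w ∉ Vc l := fun l => hw.1 l (mem_univ _)
  have hab : ∀ l, a l = b l → l = i ∨ l = j := by
    intro l h
    by_contra hne
    simp only [hbdef, if_neg hne] at h
    exact haa' l h
  set P : Finset V := univ.biUnion fun l => ({a l, b l} : Finset V) with hP
  have hmemP : ∀ v, v ∈ P ↔ ∃ l, v = a l ∨ v = b l := fun v => by simp [hP]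
  have hpair : ∀ l, ({a l, b l} : Finset V).card = if l = i ∨ l = j then 1 else 2 := by
    intro l
    by_cases h : l = i ∨ l = j
    · simp [hbdef, h]
    · rw [if_neg h, card_pair fun h' => h (hab l h')]
  have hpairV : ∀ l, ({a l, b l} : Finset V) ⊆ Vc l := by
    intro l v hv
    rw [mem_insert, mem_singleton] at hv
    rcases hv with rfl | rfl
    exacts [ha l, hb l]
  have hPV : P ⊆ univ.biUnion Vc := biUnion_mono fun l _ => hpairV l
  have hwP : w ∉ P := fun h => by
    obtain ⟨l, -, hl⟩ := mem_biUnion.1 (hPV h)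
    exact hwV l hl
  have hPcard : P.card = 2 * k - 2 := by
    rw [hP, card_biUnion fun l _ l' _ hne =>
      disjoint_of_subset_left (hpairV l) (disjoint_of_subset_right (hpairV l') (hdisj l l' hne))]
    have h1 : ∑ l : Fin k, (({a l, b l} : Finset V).card +
        if l ∈ ({i, j} : Finset (Fin k)) then 1 else 0) = 2 * k := by
      rw [sum_congr rfl (g := fun _ => 2)]
      · simp [mul_comm]
      · intro l _
        rw [hpair]
        by_cases h : l = i ∨ l = j <;> simp [h]
    rw [sum_add_distrib] at h1
    have h2 : (∑ l : Fin k, if l ∈ ({i, j} : Finset (Fin k)) then 1 else 0) = 2 := by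
      rw [sum_ite_mem]
      simp [card_pair hij]
    omega
  have hUcard : (insert w P).card = 2 * k - 1 := by
    rw [card_insert_of_notMem hwP, hPcard]
    omega
  have haU : ∀ l, a l ∈ insert w P := fun l => mem_insert_of_mem ((hmemP _).2 ⟨l, Or.inl rfl⟩)
  have hbU : ∀ l, b l ∈ insert w P := fun l => mem_insert_of_mem ((hmemP _).2 ⟨l, Or.inr rfl⟩)
  have hE' : ∀ x : Fin k → V, (∀ l, x l = a l ∨ x l = b l) → ∀ c, c = i ∨ c = j →
      insert w ((univ.erase c).image x) ∈ E := by
    intro x hx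
    refine hE x fun l => ?_
    rcases hx l with h | h <;> rw [h]
    exacts [haB l, hbB l]
  refine ⟨insert w P, hUcard, ?_, ?_, ?_, ?_⟩
  · have : insert w P \ univ.biUnion Vc = {w} := by
      ext v
      rw [mem_sdiff, mem_insert, mem_singleton]
      constructor
      · rintro ⟨rfl | h, h'⟩
        exacts [rfl, absurd (hPV h) h']
      · rintro rfl
        refine ⟨Or.inl rfl, ?_⟩
        simpa using hwV
    rw [this, card_singleton]
  · rw [disjoint_insert_left]
    refine ⟨hw.2, ?_⟩
    rw [disjoint_left]
    intro v hv
    obtain ⟨l, rfl | rfl⟩ := (hmemP v).1 hv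
    exacts [(mem_sdiff.1 (hB l (haB l))).2, (mem_sdiff.1 (hB l (hbB l))).2]
  · intro l
    rw [← hpair l]
    congr 1
    ext v
    rw [mem_inter, mem_insert]
    constructor
    · rintro ⟨rfl | hv, hvl⟩
      · exact absurd hvl (hwV l)
      · obtain ⟨l', hv⟩ := (hmemP v).1 hv
        have hvp : v ∈ ({a l', b l'} : Finset V) := by simpa using hv
        rwa [eq_of_mem_classes hdisj hvl (hpairV l' hvp)]
    · intro hv
      exact ⟨Or.inr ((hmemP v).2 ⟨l, by simpa using hv⟩), hpairV l hv⟩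
  · rintro σ ⟨z, hz, hσ⟩
    obtain rfl : z = 0 := Fin.ext (by simpa using hz)
    rcases hσ with hσ | hσ
    · exact exists_tightPath hdisj ha hb hwV hab hσ hE' (mem_insert_self _ _) haU hbU hUcard
    · rw [Equiv.swap_comm]
      exact exists_tightPath hdisj ha hb hwV (fun l h => (hab l h).symm) hσ
        (fun x hx c hc => hE' x hx c hc.symm) (mem_insert_self _ _) haU hbU hUcard

/-- Under the codegree condition, every pair of classes of a complete `(k,k)`-graph whose classes
are large outside `S` has its part of a gadget. -/
lemma exists_isEdgeGadget (k : ℕ) (hk : 3 ≤ k) (γ : ℝ) (hγ : 0 < γ) :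
    ∃ t : ℕ, ∀ (V : Type) [Fintype V] [DecidableEq V] (E : Finset (Finset V)),
      IsKGraph k E → Nonempty V →
      (∀ S : Finset V, S.card = k - 1 →
        (1 / 2 + γ) * (Fintype.card V : ℝ) ≤ (degS E S : ℝ)) →
      ∀ Vc : Fin k → Finset V, (∀ i j, i ≠ j → Disjoint (Vc i) (Vc j)) →
      ∀ S : Finset V,
        ((univ.biUnion Vc ∪ S).card : ℝ) ≤ γ * (Fintype.card V : ℝ) →
        (∀ i : Fin k, t ≤ ((Vc i) \ S).card) →
        ∀ i j, i ≠ j → ∃ W, IsEdgeGadget k E Vc S i j W := by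
  obtain ⟨t, c, hc, ht⟩ := exists_pairs k γ hγ
  refine ⟨t, ?_⟩
  intro V _ _ E hE hV hdeg Vc hdisj S hS hSt i j hij
  have hn : (0 : ℝ) < Fintype.card V := by exact_mod_cast Fintype.card_pos
  set F : Finset V := univ.biUnion Vc ∪ S with hF
  set D : Finset V → Finset V := fun T => univ.filter fun w => insert w T ∈ E with hD
  obtain ⟨B, hB, Y, hY, hYN⟩ := ht V V (fun l => Vc l \ S)
    (fun x => (D ((univ.erase i).image x) ∩ D ((univ.erase j).image x)) \ F) hSt (by
      intro x hx
      have hinj : Function.Injective x := fun l l' h =>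
        eq_of_mem_classes hdisj (mem_sdiff.1 (hx l)).1 (h ▸ (mem_sdiff.1 (hx l')).1)
      have hcard : ∀ c : Fin k, (1 / 2 + γ) * (Fintype.card V : ℝ)
          ≤ ((D ((univ.erase c).image x)).card : ℝ) := by
        intro c
        have h1 : ((univ.erase c).image x).card = k - 1 := by
          rw [card_image_of_injective _ hinj, card_erase_of_mem (mem_univ _), card_univ,
            Fintype.card_fin]
        refine (hdeg _ h1).trans ?_
        exact_mod_cast degS_le_card_extensions (by omega) hE _ h1
      have hi := hcard i
      have hj := hcard j
      generalize D ((univ.erase i).image x) = X at *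
      generalize D ((univ.erase j).image x) = Z at *
      have h1 : ((X ∪ Z).card : ℝ) + (X ∩ Z).card = X.card + Z.card := by
        exact_mod_cast card_union_add_card_inter _ _
      have h2 : ((X ∪ Z).card : ℝ) ≤ Fintype.card V := by exact_mod_cast card_le_univ _
      have h3 : ((X ∩ Z).card : ℝ) ≤ ((X ∩ Z) \ F).card + F.card := by
        exact_mod_cast card_le_card_sdiff_add_card
      linarith)
  have hYpos : 0 < Y.card := by
    have : (0 : ℝ) < Y.card := lt_of_lt_of_le (mul_pos hc hn) hY
    exact_mod_cast this
  obtain ⟨w, hwY⟩ := card_pos.1 hYpos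
  have hwE : ∀ x : Fin k → V, (∀ l, x l ∈ B l) →
      w ∈ (D ((univ.erase i).image x) ∩ D ((univ.erase j).image x)) \ F :=
    fun x hx => hYN x hx hwY
  choose y hy using fun l => card_pos.1 (by rw [(hB l).2]; exact two_pos : 0 < (B l).card)
  refine exists_isEdgeGadget_of_pairs hk hdisj hij (fun l => (hB l).1) (fun l => (hB l).2)
    (mem_sdiff.1 (hwE y hy)).2 ?_
  intro x hx c hcc
  have h := (mem_sdiff.1 (hwE x hx)).1
  rw [mem_inter] at h
  simp only [hD, mem_filter, mem_univ, true_and] at h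
  rcases hcc with rfl | rfl
  exacts [h.1, h.2]

/-- Greedy choice of pairwise disjoint gadget parts, one for each pair in `s`. -/
lemma exists_disjoint_family {α V : Type} [DecidableEq α] [DecidableEq V] (d : ℕ)
    (good : α → Finset V → Prop) (s : Finset α) (hcard : ∀ p ∈ s, ∀ W, good p W → W.card ≤ d)
    (h : ∀ p ∈ s, ∀ U : Finset V, U.card ≤ s.card * d → ∃ W, good p W ∧ Disjoint W U) :
    ∃ f : α → Finset V, (∀ p ∈ s, good p (f p)) ∧
      ∀ p ∈ s, ∀ r ∈ s, p ≠ r → Disjoint (f p) (f r) := by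
  suffices H : ∀ u ⊆ s, ∃ f : α → Finset V, (∀ p ∈ u, good p (f p)) ∧
      ∀ p ∈ u, ∀ r ∈ u, p ≠ r → Disjoint (f p) (f r) from H s Subset.rfl
  intro u
  induction u using Finset.induction_on with
  | empty => exact fun _ => ⟨fun _ => ∅, by simp, by simp⟩
  | insert x u hx ih =>
    intro hu
    obtain ⟨f, hf, hfd⟩ := ih ((subset_insert _ _).trans hu)
    obtain ⟨W, hW, hWU⟩ := h x (hu (mem_insert_self _ _)) (u.biUnion f) (by
      refine (card_biUnion_le_card_mul _ _ d fun p hp =>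
        hcard p (hu (mem_insert_of_mem hp)) _ (hf p hp)).trans ?_
      exact Nat.mul_le_mul_right _ (card_le_card ((subset_insert _ _).trans hu)))
    rw [disjoint_biUnion_right] at hWU
    have hne : ∀ p ∈ u, p ≠ x := by
      rintro p hp rfl
      exact hx hp
    refine ⟨Function.update f x W, ?_, ?_⟩
    · intro p hp
      rcases mem_insert.1 hp with rfl | hp
      · simpa using hW
      · simpa [hne p hp] using hf p hp
    · intro p hp r hr hpr
      rw [mem_insert] at hp hr
      rcases hp with rfl | hp <;> rcases hr with rfl | hr
      · exact absurd rfl hpr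
      · simpa [hne r hr] using hWU r hr
      · simpa [hne p hp] using (hWU p hp).symm
      · simpa [hne p hp, hne r hr] using hfd p hp r hr hpr

/-- in a `k`-graph with minimum codegree at least `(1/2 + γ)n`, every complete
`(k,k)`-graph `K` whose classes are large outside `S` (and with `|V(K) ∪ S| ≤ γn/2`) has a
`G`-gadget avoiding `S`, for every graph `G` on `[k]`. -/
theorem K_is_nice (k : ℕ) (hk : 3 ≤ k) (γ : ℝ) (hγ : 0 < γ) :
    ∃ n₀ t₀ : ℕ, ∀ (V : Type) [Fintype V] [DecidableEq V] (E : Finset (Finset V)),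
      IsKGraph k E → n₀ ≤ Fintype.card V →
      (∀ S : Finset V, S.card = k - 1 →
        (1 / 2 + γ) * (Fintype.card V : ℝ) ≤ (degS E S : ℝ)) →
      ∀ Vc : Fin k → Finset V, IsCompletePartite k E Vc →
      ∀ S : Finset V,
        ((Finset.univ.biUnion Vc ∪ S).card : ℝ) ≤ γ * (Fintype.card V : ℝ) / 2 →
        (∀ i : Fin k, t₀ ≤ ((Vc i) \ S).card) →
        ∀ G : SimpleGraph (Fin k), ∃ W : Fin k → Fin k → Finset V, IsGadget k E Vc G S W := by
  obtain ⟨t, ht⟩ := exists_isEdgeGadget k hk γ hγ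
  set M : ℕ := k * k * (2 * k - 1) with hM
  obtain ⟨n₀, hn₀⟩ := exists_nat_gt (2 * (M : ℝ) / γ)
  refine ⟨n₀, t + M, ?_⟩
  intro V _ _ E hE hn hdeg Vc hK S hS hSt G
  obtain ⟨hne, hdisj, -⟩ := hK
  have hV : Nonempty V := ⟨(hne ⟨0, by omega⟩).choose⟩
  have hnM : 2 * (M : ℝ) ≤ γ * Fintype.card V := by
    rw [div_lt_iff₀ hγ] at hn₀
    have : (n₀ : ℝ) ≤ Fintype.card V := by exact_mod_cast hn
    nlinarith
  set s : Finset (Fin k × Fin k) := univ.filter fun p => p.1 < p.2 with hs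
  have hscard : s.card ≤ k * k := by
    refine (card_le_univ _).trans ?_
    simp
  obtain ⟨f, hf, hfd⟩ := exists_disjoint_family (2 * k - 1)
    (fun p W => IsEdgeGadget k E Vc S p.1 p.2 W) s (fun p _ W hW => hW.1.le) (by
      intro p hp U hU
      have hUM : U.card ≤ M := hU.trans (Nat.mul_le_mul_right _ hscard)
      obtain ⟨W, h1, h2, h3, h4⟩ := ht V E hE hV hdeg Vc hdisj (S ∪ U) (by
          rw [← union_assoc]
          have h1 : ((univ.biUnion Vc ∪ S ∪ U).card : ℝ)
              ≤ (univ.biUnion Vc ∪ S).card + U.card := by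
            exact_mod_cast card_union_le _ _
          have h2 : (U.card : ℝ) ≤ M := by exact_mod_cast hUM
          linarith) (by
          intro i
          have h1 := hSt i
          have h2 : (Vc i \ S).card ≤ (Vc i \ (S ∪ U)).card + U.card := by
            have h3 : (Vc i \ S) \ U = Vc i \ (S ∪ U) := by
              ext v
              simp [and_assoc]
            rw [← h3]
            exact card_le_card_sdiff_add_card
          omega) p.1 p.2 (mem_filter.1 hp).2.ne
      rw [disjoint_union_right] at h3
      exact ⟨W, ⟨h1, h2, h3.1, h4⟩, h3.2⟩)
  have hmem : ∀ i j, G.Adj i j → (min i j, max i j) ∈ s := by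
    intro i j h
    simpa [hs] using h.ne'
  refine ⟨fun i j => f (min i j, max i j), ?_, ?_, ?_⟩
  · intro i j _
    simp only [min_comm, max_comm]
  · intro i j h
    change IsEdgeGadget k E Vc S i j (f (min i j, max i j))
    have hg := hf _ (hmem i j h)
    rcases le_total i j with hij | hij
    · simpa [hij] using hg
    · simp only [min_eq_right hij, max_eq_left hij] at hg ⊢
      exact hg.symm
  · intro i j i' j' h h' hne'
    refine hfd _ (hmem i j h) _ (hmem i' j' h') fun heq => hne' ?_
    rw [Prod.mk.injEq] at heq
    have hset : ∀ x y : Fin k, ({min x y, max x y} : Finset (Fin k)) = {x, y} := by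
      intro x y
      rcases le_total x y with hxy | hxy
      · simp [hxy]
      · simp [hxy, pair_comm]
    rw [← hset i j, ← hset i' j', heq.1, heq.2]
end

section
/- Let k ≥ 3 and s ≥ 5k² be integers with s not divisible by k. For every γ > 0 there exists n₀ such that for all n ≥ n₀: if H is a k-graph on n vertices with δ_{k−1}(H) ≥ (1/2 + γ)n, then for every pair of distinct vertices x, y ∈ V(H) there exists S ⊆ V(H) ∖ {x, y} with |S| = s − 1 such that both induced subgraphs H[S ∪ {x}] and H[S ∪ {y}] contain a spanning copy of the tight cycle C_s^k. -/
set_option autoImplicit false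

open Finset

/-- A dense `K`-ary relation on a large set contains all transversals of `K` sets of size `t`. -/
theorem exists_transversals_subset_of_dense (t : ℕ) : ∀ (K : ℕ) (c : ℝ), 0 < c →
    ∃ n₀ : ℕ, ∀ (V : Type) [Fintype V] [DecidableEq V] (R : Finset (Fin K → V)),
      n₀ ≤ Fintype.card V → c * (Fintype.card V : ℝ) ^ K ≤ (R.card : ℝ) →
      ∃ A : Fin K → Fin t → V, (∀ i, Function.Injective (A i)) ∧
        ∀ φ : Fin K → Fin t, (fun i => A i (φ i)) ∈ R := by
  intro K
  induction K with
  | zero =>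
    intro c hc
    refine ⟨0, fun V _ _ R _ hR => ?_⟩
    have hpos : 0 < R.card := by
      have : (0 : ℝ) < R.card := lt_of_lt_of_le (by simpa using hc) hR
      exact_mod_cast this
    obtain ⟨g, hg⟩ := Finset.card_pos.mp hpos
    refine ⟨fun i => i.elim0, fun i => i.elim0, fun φ => ?_⟩
    convert hg
  | succ K ih =>
    intro c hc
    obtain ⟨M, hM⟩ := exists_nat_gt (4 * t / c)
    have hMt : 4 * (t : ℝ) < c * M := by
      rw [div_lt_iff₀ hc] at hM; linarith
    have hM0 : (0 : ℝ) < M := lt_of_le_of_lt (by positivity) hM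
    obtain ⟨n₁, hn₁⟩ := ih (c / 4 / 2 ^ M) (by positivity)
    obtain ⟨n₂, hn₂⟩ := exists_nat_gt (2 * M / c)
    refine ⟨max n₁ (max n₂ 1), fun V _ _ R hV hR => ?_⟩
    have hV1 : n₁ ≤ Fintype.card V := (le_max_left _ _).trans hV
    have hV2 : (2 * M / c : ℝ) < Fintype.card V :=
      hn₂.trans_le (by exact_mod_cast ((le_max_left _ _).trans (le_max_right _ _)).trans hV)
    have hV3 : 1 ≤ Fintype.card V := ((le_max_right _ _).trans (le_max_right _ _)).trans hV
    set n : ℝ := (Fintype.card V : ℝ) with hn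
    have hn0 : 0 < n := by rw [hn]; exact_mod_cast hV3
    set N : ℝ := n ^ K with hN
    have hN0 : 0 < N := by positivity
    have hNcard : ((Finset.univ : Finset (Fin K → V)).card : ℝ) = N := by
      simp [hN, hn]
    let D : V → Finset (Fin K → V) := fun w =>
      Finset.univ.filter fun p => (Fin.cons w p : Fin (K + 1) → V) ∈ R
    have hDle : ∀ w, ((D w).card : ℝ) ≤ N := fun w => by
      rw [← hNcard]; exact_mod_cast Finset.card_le_univ _
    have hRsum : (R.card : ℝ) ≤ ∑ w : V, ((D w).card : ℝ) := by
      have h1 : R.card = ∑ w : V, (R.filter fun g => g 0 = w).card :=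
        Finset.card_eq_sum_card_fiberwise (fun _ _ => Finset.mem_coe.2 (Finset.mem_univ _))
      rw [h1]
      push_cast
      refine Finset.sum_le_sum fun w _ => ?_
      norm_cast
      refine Finset.card_le_card_of_injOn Fin.tail ?_ ?_
      · intro g hg
        simp only [Finset.coe_filter, Set.mem_ofPred_eq] at hg
        simp only [D, Finset.coe_filter, Set.mem_ofPred_eq, Finset.mem_univ, true_and]
        rw [← hg.2, Fin.cons_self_tail]; exact hg.1
      · intro g hg g' hg' h
        simp only [Finset.coe_filter, Set.mem_ofPred_eq] at hg hg'
        rw [← Fin.cons_self_tail g, ← Fin.cons_self_tail g', h, hg.2, hg'.2]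
    let W₀ : Finset V := Finset.univ.filter fun w => c / 2 * N ≤ ((D w).card : ℝ)
    have hW₀ : c / 2 * n ≤ (W₀.card : ℝ) := by
      have h2 : ∑ w : V, ((D w).card : ℝ) ≤ ∑ w : V, ((if w ∈ W₀ then N else 0) + c / 2 * N) := by
        refine Finset.sum_le_sum fun w _ => ?_
        split_ifs with h
        · have := hDle w
          have : 0 ≤ c / 2 * N := by positivity
          linarith
        · have : ¬ (c / 2 * N ≤ ((D w).card : ℝ)) := fun h' => h (by simp [W₀, h'])
          linarith
      rw [Finset.sum_add_distrib, ← Finset.sum_filter] at h2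
      simp only [Finset.sum_const, Finset.filter_mem_eq_inter, Finset.univ_inter, nsmul_eq_mul,
        Finset.card_univ] at h2
      rw [← hn] at h2
      have h3 : c * n ^ (K + 1) = c * n * N := by rw [hN, pow_succ]; ring
      rw [h3] at hR
      have h4 : c / 2 * n * N ≤ (W₀.card : ℝ) * N := by linarith
      exact le_of_mul_le_mul_right h4 hN0
    have hMW : M ≤ W₀.card := by
      have : (M : ℝ) ≤ W₀.card := by
        rw [div_lt_iff₀ hc] at hV2; linarith
      exact_mod_cast this
    obtain ⟨W, hWsub, hWcard⟩ := Finset.exists_subset_card_eq hMW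
    let L : (Fin K → V) → Finset V := fun p =>
      W.filter fun w => (Fin.cons w p : Fin (K + 1) → V) ∈ R
    let P : Finset (Fin K → V) := Finset.univ.filter fun p => t ≤ (L p).card
    have hP : c / 4 * N ≤ (P.card : ℝ) := by
      have h1 : ∑ w ∈ W, (D w).card = ∑ p : Fin K → V, (L p).card :=
        Finset.sum_card_bipartiteAbove_eq_sum_card_bipartiteBelow
          (fun w p => (Fin.cons w p : Fin (K + 1) → V) ∈ R)
      have h2 : (M : ℝ) * (c / 2 * N) ≤ ∑ w ∈ W, ((D w).card : ℝ) := by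
        rw [← hWcard, ← nsmul_eq_mul]
        refine Finset.card_nsmul_le_sum _ _ _ fun w hw => ?_
        exact (Finset.mem_filter.mp (hWsub hw)).2
      have h3 : ∑ p : Fin K → V, ((L p).card : ℝ) ≤
          ∑ p : Fin K → V, ((if p ∈ P then (M : ℝ) else 0) + t) := by
        refine Finset.sum_le_sum fun p _ => ?_
        split_ifs with h
        · have : ((L p).card : ℝ) ≤ M := by
            rw [← hWcard]; exact_mod_cast Finset.card_filter_le _ _
          have : (0 : ℝ) ≤ t := by positivity
          linarith
        · have h' : (L p).card < t := by
            by_contra h'; exact h (by simp [P]; omega)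
          have : ((L p).card : ℝ) < t := by exact_mod_cast h'
          linarith
      rw [Finset.sum_add_distrib, ← Finset.sum_filter] at h3
      simp only [Finset.sum_const, Finset.filter_mem_eq_inter, Finset.univ_inter,
        nsmul_eq_mul] at h3
      rw [hNcard] at h3
      have h4 : ∑ w ∈ W, ((D w).card : ℝ) = ∑ p : Fin K → V, ((L p).card : ℝ) := by
        exact_mod_cast h1
      have h5 : 4 * (t : ℝ) * N ≤ c * M * N := mul_le_mul_of_nonneg_right hMt.le hN0.le
      have h6 : c / 4 * N * M ≤ (P.card : ℝ) * M := by linarith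
      exact le_of_mul_le_mul_right h6 hM0
    let Q : Finset V → Finset (Fin K → V) := fun T =>
      Finset.univ.filter fun p => ∀ w ∈ T, (Fin.cons w p : Fin (K + 1) → V) ∈ R
    have hPQ : P ⊆ (W.powersetCard t).biUnion Q := by
      intro p hp
      obtain ⟨T, hT, hTc⟩ := Finset.exists_subset_card_eq (Finset.mem_filter.mp hp).2
      refine Finset.mem_biUnion.mpr ⟨T, Finset.mem_powersetCard.mpr
        ⟨hT.trans (Finset.filter_subset _ _), hTc⟩, ?_⟩
      exact Finset.mem_filter.mpr ⟨Finset.mem_univ _, fun w hw => (Finset.mem_filter.mp (hT hw)).2⟩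
    obtain ⟨T, hT, hTQ⟩ : ∃ T ∈ W.powersetCard t, c / 4 / 2 ^ M * N ≤ ((Q T).card : ℝ) := by
      by_contra! hcon
      have h1 : (P.card : ℝ) ≤ ∑ T ∈ W.powersetCard t, ((Q T).card : ℝ) := by
        exact_mod_cast (Finset.card_le_card hPQ).trans Finset.card_biUnion_le
      have hne : (W.powersetCard t).Nonempty := by
        by_contra hne
        rw [Finset.not_nonempty_iff_eq_empty] at hne
        rw [hne] at h1
        have : 0 < c / 4 * N := by positivity
        simp only [Finset.sum_empty] at h1
        linarith
      have h2 := Finset.sum_lt_sum_of_nonempty hne hcon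
      rw [Finset.sum_const, nsmul_eq_mul] at h2
      have h3 : ((W.powersetCard t).card : ℝ) ≤ 2 ^ M := by
        rw [Finset.card_powersetCard, hWcard]
        exact_mod_cast Nat.choose_le_two_pow M t
      have h4 : ((W.powersetCard t).card : ℝ) * (c / 4 / 2 ^ M * N) ≤
          2 ^ M * (c / 4 / 2 ^ M * N) := by gcongr
      have h5 : (2 : ℝ) ^ M * (c / 4 / 2 ^ M * N) = c / 4 * N := by field_simp
      linarith
    obtain ⟨A, hA, hAR⟩ := hn₁ V (Q T) hV1 hTQ
    have hTc := (Finset.mem_powersetCard.mp hT).2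
    let e : Fin t → V := fun i => (T.equivFinOfCardEq hTc).symm i
    refine ⟨Fin.cons e A, ?_, ?_⟩
    · intro i
      refine Fin.cases ?_ ?_ i
      · rw [Fin.cons_zero]
        exact Subtype.val_injective.comp (Equiv.injective _)
      · intro j; rw [Fin.cons_succ]; exact hA j
    · intro φ
      have h1 := (Finset.mem_filter.mp (hAR fun i => φ i.succ)).2 (e (φ 0))
        ((T.equivFinOfCardEq hTc).symm (φ 0)).2
      convert h1 using 1
      funext i
      refine Fin.cases ?_ ?_ i
      · simp
      · intro j; simp

/-- Choosing entries one after the other with at least `m` options each time yields at least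
`m ^ K` tuples. -/
theorem pow_le_card_of_sequential_choices {V : Type} [Fintype V] [DecidableEq V] (x₀ : V)
    (m : ℝ) (hm : 0 ≤ m) (Q : ℕ → (ℕ → V) → Prop)
    (hcongr : ∀ j g g', (∀ i ≤ j, g i = g' i) → Q j g → Q j g') (K : ℕ)
    (hQ : ∀ j < K, ∀ g, (∀ i < j, Q i g) →
      ∃ F : Finset V, m ≤ F.card ∧ ∀ v ∈ F, Q j (Function.update g j v)) :
    ∃ R : Finset (Fin K → V), m ^ K ≤ (R.card : ℝ) ∧
      ∀ h ∈ R, ∀ g : ℕ → V, (∀ i : Fin K, g i = h i) → ∀ j < K, Q j g := by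
  classical
  induction K with
  | zero => exact ⟨Finset.univ, by simp, fun _ _ _ _ j hj => absurd hj (Nat.not_lt_zero j)⟩
  | succ K ih =>
    obtain ⟨R, hR, hRQ⟩ := ih fun j hj => hQ j (hj.trans (Nat.lt_succ_self K))
    let ext : (Fin K → V) → ℕ → V := fun h i => if hi : i < K then h ⟨i, hi⟩ else x₀
    have hext : ∀ h (i : Fin K), ext h i = h i := fun h i => by simp [ext]
    have hF : ∀ h, ∃ F : Finset V, h ∈ R →
        m ≤ F.card ∧ ∀ v ∈ F, Q K (Function.update (ext h) K v) := by
      intro h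
      by_cases hh : h ∈ R
      · obtain ⟨F, hF⟩ := hQ K (Nat.lt_succ_self K) (ext h) (hRQ h hh _ (hext h))
        exact ⟨F, fun _ => hF⟩
      · exact ⟨∅, fun h' => absurd h' hh⟩
    choose F hF using hF
    refine ⟨(R.sigma F).image fun p => (Fin.snoc p.1 p.2 : Fin (K + 1) → V), ?_, ?_⟩
    · rw [Finset.card_image_of_injective, Finset.card_sigma]
      · push_cast
        calc m ^ (K + 1) = m ^ K * m := pow_succ _ _
          _ ≤ R.card * m := by gcongr
          _ ≤ ∑ h ∈ R, ((F h).card : ℝ) := by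
            rw [← nsmul_eq_mul]
            exact Finset.card_nsmul_le_sum _ _ _ fun h hh => (hF h hh).1
      · rintro ⟨p, v⟩ ⟨p', v'⟩ h
        have h1 := congrArg Fin.init h
        have h2 := congrFun h (Fin.last K)
        simp only [Fin.init_snoc, Fin.snoc_last] at h1 h2
        subst h1; subst h2; rfl
    · intro h' hh' g hg j hj
      obtain ⟨⟨h, v⟩, hp, rfl⟩ := Finset.mem_image.mp hh'
      obtain ⟨h1, h2⟩ := Finset.mem_sigma.mp hp
      have hgh : ∀ i : Fin K, g i = h i := fun i => by
        have := hg i.castSucc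
        simpa using this
      rcases Nat.lt_succ_iff_lt_or_eq.mp hj with hj | rfl
      · exact hRQ h h1 g hgh j hj
      · refine hcongr j _ _ ?_ ((hF h h1).2 v h2)
        intro i hi
        rcases hi.lt_or_eq with hi | rfl
        · rw [Function.update_of_ne hi.ne, hext h ⟨i, hi⟩]
          exact (hgh ⟨i, hi⟩).symm
        · have := hg (Fin.last i)
          simpa using this.symm

section Neighbourhoods

variable {V : Type} [Fintype V] [DecidableEq V]

theorem degS_le_card_filter_insert_mem {k : ℕ} (hk : 1 ≤ k) {E : Finset (Finset V)}
    (hE : IsKGraph k E) {S : Finset V} (hS : S.card = k - 1) :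
    degS E S ≤ (Finset.univ.filter fun v => insert v S ∈ E).card := by
  refine (Finset.card_le_card (t := (Finset.univ.filter fun v => insert v S ∈ E).image
    fun v => insert v S) ?_).trans Finset.card_image_le
  intro e he
  obtain ⟨he, hSe⟩ := Finset.mem_filter.mp he
  have hc : (e \ S).card = 1 := by
    rw [Finset.card_sdiff_of_subset hSe, hE e he, hS]; omega
  obtain ⟨v, hv⟩ := Finset.card_eq_one.mp hc
  have hins : insert v S = e := by
    rw [Finset.insert_eq, ← hv, Finset.sdiff_union_of_subset hSe]
  exact Finset.mem_image.mpr ⟨v, by simp [hins, he], hins⟩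

theorem two_mul_le_card_common_neighbours {k : ℕ} (hk : 1 ≤ k) {E : Finset (Finset V)}
    (hE : IsKGraph k E) {γ : ℝ}
    (hdeg : ∀ S : Finset V, S.card = k - 1 →
      (1 / 2 + γ) * (Fintype.card V : ℝ) ≤ (degS E S : ℝ))
    {S T : Finset V} (hS : S.card = k - 1) (hT : T.card = k - 1) :
    2 * γ * Fintype.card V ≤
      ((Finset.univ.filter fun v => insert v S ∈ E ∧ insert v T ∈ E).card : ℝ) := by
  have h1 : (degS E S : ℝ) ≤ (Finset.univ.filter fun v => insert v S ∈ E).card := by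
    exact_mod_cast degS_le_card_filter_insert_mem hk hE hS
  have h2 : (degS E T : ℝ) ≤ (Finset.univ.filter fun v => insert v T ∈ E).card := by
    exact_mod_cast degS_le_card_filter_insert_mem hk hE hT
  have h3 := Finset.card_union_add_card_inter (Finset.univ.filter fun v => insert v S ∈ E)
    (Finset.univ.filter fun v => insert v T ∈ E)
  rw [← Finset.filter_and] at h3
  have h4 := Finset.card_le_univ ((Finset.univ.filter fun v => insert v S ∈ E) ∪
    (Finset.univ.filter fun v => insert v T ∈ E))
  have h5 := hdeg S hS
  have h6 := hdeg T hT
  rify at h3 h4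
  linarith

end Neighbourhoods

/-- The index of the vertex in position `i` of the ordering `0, …, k - 1` rotated by `r`. -/
def rotIdx (k r i : ℕ) : ℕ := if i < r then i + k - r else i - r

/-- The indices in a sequence of blocks of length `k`, each block differing from the next one in
at most one position: the first blocks are `0, …, k - 1`, whose entries are replaced one by one
by `k, …, 2k - 1`, which in turn are replaced, from the last to the first, by the
rotation of `0, …, k - 1` by `r`. -/
def blockIdx (k r m i : ℕ) : ℕ :=
  if m ≤ k + 1 then (if i + 1 < m then k + i else i)
  else if i + m < 2 * k + 1 then k + i else rotIdx k r i

theorem rotIdx_lt {k r i : ℕ} (hr : r < k) (hi : i < k) : rotIdx k r i < k := by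
  unfold rotIdx; split_ifs <;> omega

theorem rotIdx_inj {k r i j : ℕ} (hr : r < k) (hi : i < k) (hj : j < k)
    (h : rotIdx k r i = rotIdx k r j) : i = j := by
  unfold rotIdx at h; split_ifs at h <;> omega

theorem image_rotIdx_range {k r : ℕ} (hr : r < k) :
    (range k).image (rotIdx k r) = range k := by
  refine Finset.eq_of_subset_of_card_le ?_ ?_
  · intro i hi
    obtain ⟨j, hj, rfl⟩ := Finset.mem_image.mp hi
    exact Finset.mem_range.mpr (rotIdx_lt hr (Finset.mem_range.mp hj))
  · rw [Finset.card_image_of_injOn]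
    intro i hi j hj h
    exact rotIdx_inj hr (by simpa using hi) (by simpa using hj) h

theorem blockIdx_lt {k r m i : ℕ} (hr : r < k) (hi : i < k) : blockIdx k r m i < 2 * k := by
  have := rotIdx_lt hr hi
  unfold blockIdx; split_ifs <;> omega

theorem exists_forall_ne_blockIdx_succ_eq (k r m : ℕ) :
    ∃ z, ∀ i < k, i ≠ z → blockIdx k r (m + 1) i = blockIdx k r m i := by
  refine ⟨if m ≤ k then m - 1 else 2 * k - m, fun i hi hz => ?_⟩
  unfold blockIdx
  split_ifs at hz ⊢ <;> omega

section Configuration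

variable {V : Type} [DecidableEq V]

/-- The requirements on the `j`-th entry of `g`, given the earlier ones, for `g` to make all blocks
of indices edges and `g 0, …, g (k - 2)` a common link edge of `x` and `y`. -/
def IsGoodEntry (k r : ℕ) (E : Finset (Finset V)) (x y : V) (j : ℕ) (g : ℕ → V) : Prop :=
  g j ≠ x ∧ g j ≠ y ∧ (∀ i < j, g i ≠ g j) ∧
  (j + 2 = k → insert x ((range (k - 1)).image g) ∈ E ∧
    insert y ((range (k - 1)).image g) ∈ E) ∧
  (j + 1 = k → (range k).image g ∈ E) ∧
  ∀ l < k, j = k + l →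
    ((range k).image fun i => g (if i ≤ l then k + i else i)) ∈ E ∧
    ((range k).image fun i => g (if i ≤ l then k + i else rotIdx k r i)) ∈ E

theorem IsGoodEntry.congr {k r : ℕ} (hr : r < k) {E : Finset (Finset V)} {x y : V} {j : ℕ}
    {g g' : ℕ → V} (h : ∀ i ≤ j, g i = g' i) (hg : IsGoodEntry k r E x y j g) :
    IsGoodEntry k r E x y j g' := by
  obtain ⟨h1, h2, h3, h4, h5, h6⟩ := hg
  have key : ∀ (N : ℕ) (B : ℕ → ℕ), (∀ i < N, B i ≤ j) →
      ((range N).image fun i => g (B i)) = (range N).image fun i => g' (B i) := fun N B hB =>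
    Finset.image_congr fun i hi => h _ (hB i (by simpa using hi))
  refine ⟨h j le_rfl ▸ h1, h j le_rfl ▸ h2, fun i hi => ?_, fun hj => ?_, fun hj => ?_,
    fun l hl hj => ?_⟩
  · rw [← h i hi.le, ← h j le_rfl]; exact h3 i hi
  · have := key (k - 1) id (fun i hi => by simp; omega)
    simp only [id] at this
    rw [← this]; exact h4 hj
  · have := key k id (fun i hi => by simp; omega)
    simp only [id] at this
    rw [← this]; exact h5 hj
  · rw [← key k _ (fun i hi => by split_ifs <;> omega),
      ← key k _ (fun i hi => by have := rotIdx_lt hr hi; split_ifs <;> omega)]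
    exact h6 l hl hj

theorem image_blockIdx_mem {k r : ℕ} (hk : 3 ≤ k) (hr : r < k) {E : Finset (Finset V)} {x y : V}
    {g : ℕ → V} (hg : ∀ j < 2 * k, IsGoodEntry k r E x y j g) (m : ℕ) :
    ((range k).image fun i => g (blockIdx k r m i)) ∈ E := by
  have hid : (range k).image g ∈ E := (hg (k - 1) (by omega)).2.2.2.2.1 (by omega)
  have hgl : ∀ l < k, _ := fun l hl => (hg (k + l) (by omega)).2.2.2.2.2 l hl rfl
  rcases Nat.lt_or_ge m 2 with h | h
  · convert hid using 2
    funext i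
    congr 1
    unfold blockIdx; split_ifs <;> omega
  rcases Nat.lt_or_ge m (k + 2) with h' | h'
  · convert (hgl (m - 2) (by omega)).1 using 2
    funext i
    congr 1
    unfold blockIdx; split_ifs <;> omega
  rcases Nat.lt_or_ge m (2 * k + 1) with h'' | h''
  · convert (hgl (2 * k - m) (by omega)).2 using 2
    funext i
    congr 1
    unfold blockIdx; split_ifs <;> omega
  · rw [← image_rotIdx_range hr, Finset.image_image] at hid
    convert hid using 2
    funext i
    simp only [Function.comp]
    congr 1
    unfold blockIdx; split_ifs <;> omega

theorem blockIdx_injOn {k r : ℕ} (hr : r < k) (m : ℕ) :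
    Set.InjOn (blockIdx k r m) (range k : Finset ℕ) := by
  intro i hi j hj h
  simp only [Finset.coe_range, Set.mem_Iio] at hi hj
  have h1 := rotIdx_lt hr hi
  have h2 := rotIdx_lt hr hj
  have h3 := rotIdx_inj hr hi hj
  unfold blockIdx at h
  split_ifs at h <;> omega

theorem exists_good_entries [Fintype V] {k r : ℕ} (hk : 3 ≤ k) (hr : r < k)
    {E : Finset (Finset V)} (hE : IsKGraph k E) {γ : ℝ}
    (hn : (2 * k + 2 : ℝ) ≤ γ * Fintype.card V) (hkV : k ≤ Fintype.card V)
    (hdeg : ∀ S : Finset V, S.card = k - 1 →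
      (1 / 2 + γ) * (Fintype.card V : ℝ) ≤ (degS E S : ℝ))
    {x y : V} {j : ℕ} (hj : j < 2 * k) (g : ℕ → V)
    (hg : ∀ i < j, IsGoodEntry k r E x y i g) :
    ∃ F : Finset V, γ * Fintype.card V ≤ F.card ∧
      ∀ v ∈ F, IsGoodEntry k r E x y j (Function.update g j v) := by
  have hinj : Set.InjOn g (Set.Iio j) := by
    intro a ha b hb hab
    rcases lt_trichotomy a b with h | h | h
    · exact absurd hab ((hg b hb).2.2.1 a h)
    · exact h
    · exact absurd hab.symm ((hg a ha).2.2.1 b h)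
  -- it suffices to find two sets whose common neighbours satisfy the edge conditions
  suffices hST : ∃ S T : Finset V, S.card = k - 1 ∧ T.card = k - 1 ∧
      ∀ v, insert v S ∈ E → insert v T ∈ E →
        (j + 2 = k → insert x ((range (k - 1)).image (Function.update g j v)) ∈ E ∧
          insert y ((range (k - 1)).image (Function.update g j v)) ∈ E) ∧
        (j + 1 = k → (range k).image (Function.update g j v) ∈ E) ∧
        ∀ l < k, j = k + l →
          ((range k).image fun i =>
            Function.update g j v (if i ≤ l then k + i else i)) ∈ E ∧
          ((range k).image fun i =>
            Function.update g j v (if i ≤ l then k + i else rotIdx k r i)) ∈ E by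
    obtain ⟨S, T, hS, hT, hST⟩ := hST
    refine ⟨(Finset.univ.filter fun v => insert v S ∈ E ∧ insert v T ∈ E) \
      (insert x (insert y ((range j).image g))), ?_, ?_⟩
    · have h1 := two_mul_le_card_common_neighbours (by omega) hE hdeg hS hT
      have h2 := Finset.le_card_sdiff (insert x (insert y ((range j).image g)))
        (Finset.univ.filter fun v => insert v S ∈ E ∧ insert v T ∈ E)
      have h3 : (insert x (insert y ((range j).image g))).card ≤ 2 * k + 2 := by
        have a1 := Finset.card_insert_le x (insert y ((range j).image g))
        have a2 := Finset.card_insert_le y ((range j).image g)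
        have a3 := Finset.card_image_le (s := range j) (f := g)
        rw [Finset.card_range] at a3
        omega
      rw [tsub_le_iff_right] at h2
      rify at h2 h3
      linarith
    · intro v hv
      simp only [Finset.mem_sdiff, Finset.mem_filter, Finset.mem_univ, true_and,
        Finset.mem_insert, Finset.mem_image, Finset.mem_range, not_or, not_exists, not_and] at hv
      obtain ⟨⟨hvS, hvT⟩, hvx, hvy, hvg⟩ := hv
      refine ⟨by simpa using hvx, by simpa using hvy, fun i hi => ?_, hST v hvS hvT⟩
      rw [Function.update_of_ne hi.ne, Function.update_self]
      exact hvg i hi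
  have hins : ∀ (N a : ℕ) (B : ℕ → ℕ) (v : V), a < N → B a = j → (∀ i < N, i ≠ a → B i ≠ j) →
      (range N).image (fun i => Function.update g j v (B i)) =
        insert v (((range N).erase a).image fun i => g (B i)) := by
    intro N a B v ha hBa hB
    conv_lhs => rw [← Finset.insert_erase (Finset.mem_range.mpr ha)]
    rw [Finset.image_insert, hBa, Function.update_self]
    congr 1
    refine Finset.image_congr fun i hi => ?_
    simp only [Finset.coe_erase, Finset.coe_range, Set.mem_sdiff, Set.mem_Iio,
      Set.mem_singleton_iff] at hi
    exact Function.update_of_ne (hB i hi.1 hi.2) _ _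
  have hcard : ∀ (N a : ℕ) (B : ℕ → ℕ), a < N → (∀ i < N, i ≠ a → B i < j) →
      (∀ i < N, ∀ i' < N, B i = B i' → i = i') →
      (((range N).erase a).image fun i => g (B i)).card = N - 1 := by
    intro N a B ha hB hBi
    rw [Finset.card_image_of_injOn, Finset.card_erase_of_mem (Finset.mem_range.mpr ha),
      Finset.card_range]
    intro i hi i' hi' h
    simp only [Finset.coe_erase, Finset.coe_range, Set.mem_sdiff, Set.mem_Iio,
      Set.mem_singleton_iff] at hi hi'
    exact hBi i hi.1 i' hi'.1 (hinj (hB i hi.1 hi.2) (hB i' hi'.1 hi'.2) h)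
  by_cases hj1 : j + 2 = k
  · have hx : ∀ z : V, (∀ i < j, g i ≠ z) →
        (insert z (((range (k - 1)).erase j).image g)).card = k - 1 := by
      intro z hz
      have hc := hcard (k - 1) j id (by omega)
        (fun i hi hi' => by simp only [id]; omega) (fun _ _ _ _ h => h)
      simp only [id] at hc
      rw [Finset.card_insert_of_notMem, hc]
      · omega
      · intro hmem
        obtain ⟨i, hi, h⟩ := Finset.mem_image.mp hmem
        rw [Finset.mem_erase, Finset.mem_range] at hi
        exact hz i (by omega) h
    refine ⟨_, _, hx x fun i hi => (hg i hi).1, hx y fun i hi => (hg i hi).2.1,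
      fun v hvS hvT => ⟨fun _ => ?_, fun _ => by omega, fun l _ _ => by omega⟩⟩
    have := hins (k - 1) j id v (by omega) rfl (fun i _ h => h)
    simp only [id] at this
    rw [show (Function.update g j v) = fun i => Function.update g j v i from rfl, this,
      Finset.insert_comm x, Finset.insert_comm y]
    exact ⟨hvS, hvT⟩
  by_cases hj2 : j + 1 = k
  · have hc := hcard k j id (by omega) (fun i hi hi' => by simp only [id]; omega)
      (fun _ _ _ _ h => h)
    refine ⟨_, _, hc, hc, fun v hvS _ => ⟨fun _ => by omega, fun _ => ?_, fun l _ _ => by omega⟩⟩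
    have := hins k j id v (by omega) rfl (fun i _ h => h)
    simp only [id] at this hvS
    rw [show (Function.update g j v) = fun i => Function.update g j v i from rfl, this]
    exact hvS
  by_cases hj3 : k ≤ j
  · obtain ⟨l, rfl⟩ := Nat.exists_eq_add_of_le hj3
    have hu : ∀ i < k, rotIdx k r i < k := fun i hi => rotIdx_lt hr hi
    refine ⟨_, _,
      hcard k l (fun i => if i ≤ l then k + i else i) (by omega)
        (fun i hi hi' => by split_ifs <;> omega)
        (fun i hi i' hi' h => by split_ifs at h <;> omega),
      hcard k l (fun i => if i ≤ l then k + i else rotIdx k r i) (by omega)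
        (fun i hi hi' => by have := hu i hi; split_ifs <;> omega)
        (fun i hi i' hi' h => by
          have h1 := hu i hi
          have h2 := hu i' hi'
          have h3 := rotIdx_inj hr hi hi'
          split_ifs at h <;> omega),
      fun v hvS hvT => ⟨fun _ => by omega, fun _ => by omega, fun l' _ hl' => ?_⟩⟩
    obtain rfl : l = l' := by omega
    rw [hins k l (fun i => if i ≤ l then k + i else i) v (by omega) (by simp)
        (fun i hi hi' => by split_ifs <;> omega),
      hins k l (fun i => if i ≤ l then k + i else rotIdx k r i) v (by omega) (by simp)
        (fun i hi hi' => by have := hu i hi; split_ifs <;> omega)]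
    exact ⟨hvS, hvT⟩
  · obtain ⟨S, -, hS⟩ := Finset.exists_subset_card_eq
      (show k - 1 ≤ (Finset.univ : Finset V).card by rw [Finset.card_univ]; omega)
    exact ⟨S, S, hS, hS, fun v _ _ => ⟨fun _ => by omega, fun _ => by omega,
      fun l _ _ => by omega⟩⟩

end Configuration

section Cycle

variable {V : Type} [DecidableEq V]

/-- The vertex list of the cycle through `z` following the blocks of indices, where `a c p` is
the vertex used for the index `c` at position `p`. -/
def cycleVertex (k s : ℕ) (a : ℕ → ℕ → V) (z : V) (p : ℕ) : V :=
  if p = k - 1 then z else a (blockIdx k (s % k) (p / k) (p % k)) p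

theorem toFinset_window_map_range {s k i : ℕ} (hks : k ≤ s) (hi : i < s) (f : ℕ → V) :
    ((((List.range s).map f ++ (List.range s).map f).drop i).take k).toFinset =
      (range k).image fun j => f ((i + j) % s) := by
  have hlen : ((((List.range s).map f ++ (List.range s).map f).drop i).take k) =
      (List.range k).map fun j => f ((i + j) % s) := by
    apply List.ext_getElem
    · simp; omega
    · intro j h1 h2
      simp only [List.length_map, List.length_range] at h2
      rw [List.getElem_take, List.getElem_drop, List.getElem_append]
      simp only [List.length_map, List.length_range, List.getElem_map, List.getElem_range]
      split_ifs with h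
      · rw [Nat.mod_eq_of_lt h]
      · rw [Nat.mod_eq_sub_mod (by omega), Nat.mod_eq_of_lt (by omega)]
  rw [hlen]
  ext v
  simp

theorem window_eq_image_pos {s k i : ℕ} (hi : i < s) (pos : ℕ → ℕ)
    (hpos : ∀ j < k, pos j < s ∧ (i ≤ pos j ∧ pos j < i + k ∨ pos j + s < i + k))
    (hinj : ∀ j < k, ∀ j' < k, pos j = pos j' → j = j') :
    ((range k).image fun j => (i + j) % s) = (range k).image pos := by
  symm
  refine Finset.eq_of_subset_of_card_le ?_ ?_
  · intro p hp
    obtain ⟨j, hj, rfl⟩ := Finset.mem_image.mp hp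
    rw [Finset.mem_range] at hj
    obtain ⟨h1, h2⟩ := hpos j hj
    rw [Finset.mem_image]
    rcases h2 with h2 | h2
    · exact ⟨pos j - i, Finset.mem_range.mpr (by omega), by
        rw [Nat.add_sub_cancel' h2.1, Nat.mod_eq_of_lt h1]⟩
    · exact ⟨pos j + s - i, Finset.mem_range.mpr (by omega), by
        rw [Nat.add_sub_cancel' (by omega), Nat.add_mod_right, Nat.mod_eq_of_lt h1]⟩
  · rw [Finset.card_image_of_injOn (s := range k) (f := pos)]
    · exact Finset.card_image_le
    · intro j hj j' hj' h
      exact hinj j (by simpa using hj) j' (by simpa using hj') h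

theorem blockIdx_of_le_one {k r m i : ℕ} (hk : 1 ≤ k) (hm : m ≤ 1) : blockIdx k r m i = i := by
  unfold blockIdx; split_ifs <;> omega

theorem blockIdx_wrap {k s i : ℕ} (hk : 3 ≤ k) (hs : 2 * k * k + 2 * k ≤ s) (hi : i < k) :
    blockIdx k (s % k) ((s - k + i) / k) ((s - k + i) % k) = i := by
  have hr : s % k < k := Nat.mod_lt _ (by omega)
  have hdiv : 2 * k + 1 ≤ (s - k + i) / k := by
    rw [Nat.le_div_iff_mul_le (by omega)]
    have : (2 * k + 1) * k = 2 * k * k + k := by ring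
    omega
  have hmod : (s - k + i) % k = (s % k + i) % k := by
    rw [Nat.mod_add_mod, show s + i = (s - k + i) + k by omega, Nat.add_mod_right]
  have hmod' : (s - k + i) % k = if s % k + i < k then s % k + i else s % k + i - k := by
    rw [hmod]
    split_ifs with h
    · exact Nat.mod_eq_of_lt h
    · rw [Nat.mod_eq_sub_mod (by omega), Nat.mod_eq_of_lt (by omega)]
  rw [hmod']
  unfold blockIdx rotIdx
  split_ifs <;> omega

variable {k s : ℕ} {E : Finset (Finset V)} {x y : V} {a : ℕ → ℕ → V}

/-- Choosing, for the indices in a block, arbitrary positions yields an edge. -/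
theorem image_transversal_mem (hk : 3 ≤ k) {r : ℕ} (hr : r < k)
    (ha : ∀ φ : ℕ → ℕ, (∀ c, φ c < s) → ∀ j < 2 * k,
      IsGoodEntry k r E x y j fun c => a c (φ c))
    (m : ℕ) (pos : ℕ → ℕ) (hs : 0 < s) (hpos : ∀ i < k, pos i < s) :
    ((range k).image fun i => a (blockIdx k r m i) (pos i)) ∈ E := by
  classical
  let φ : ℕ → ℕ := fun c =>
    if h : ∃ i < k, blockIdx k r m i = c then pos h.choose else 0
  have hφ : ∀ c, φ c < s := by
    intro c
    simp only [φ]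
    split_ifs with h
    · exact hpos _ h.choose_spec.1
    · exact hs
  convert image_blockIdx_mem hk hr (ha φ hφ) m using 1
  refine Finset.image_congr fun i hi => ?_
  have hi' : i < k := by simpa using hi
  have h : ∃ i' < k, blockIdx k r m i' = blockIdx k r m i := ⟨i, hi', rfl⟩
  have : φ (blockIdx k r m i) = pos i := by
    simp only [φ, dif_pos h]
    congr 1
    exact blockIdx_injOn hr m (by simpa using h.choose_spec.1) hi h.choose_spec.2
  simp only [this]

theorem isTightCycleList_cycleVertex (hk : 3 ≤ k) (hs : 2 * k * k + 2 * k ≤ s)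
    (hinj : ∀ c < 2 * k, ∀ p < s, ∀ q < s, a c p = a c q → p = q)
    (ha : ∀ φ : ℕ → ℕ, (∀ c, φ c < s) → ∀ j < 2 * k,
      IsGoodEntry k (s % k) E x y j fun c => a c (φ c))
    {z : V} (hz : z = x ∨ z = y) :
    IsTightCycleList k E ((List.range s).map (cycleVertex k s a z)) := by
  have hr : s % k < k := Nat.mod_lt _ (by omega)
  have hs0 : 0 < s := by omega
  have hcol : ∀ p, blockIdx k (s % k) (p / k) (p % k) < 2 * k := fun p =>
    blockIdx_lt hr (Nat.mod_lt _ (by omega))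
  have hne : ∀ c < 2 * k, ∀ p < s, a c p ≠ z := by
    intro c hc p hp
    have := ha (fun _ => p) (fun _ => hp) c hc
    rcases hz with rfl | rfl
    · exact this.1
    · exact this.2.1
  have hdisj : ∀ c c', c < c' → c' < 2 * k → ∀ p < s, ∀ q < s, a c p ≠ a c' q := by
    intro c c' hcc hc' p hp q hq
    have := (ha (fun d => if d = c then p else q)
      (fun d => by split_ifs <;> assumption) c' hc').2.2.1 c hcc
    simpa [hcc.ne'] using this
  have hlink : ∀ pos : ℕ → ℕ, (∀ i < k, pos i < s) →
      insert z ((range (k - 1)).image fun i => a i (pos i)) ∈ E := by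
    intro pos hpos
    have h := (ha (fun c => if c < k then pos c else 0)
      (fun c => by split_ifs with h; exacts [hpos c h, hs0]) (k - 2) (by omega)).2.2.2.1 (by omega)
    have heq : ((range (k - 1)).image fun c => a c (if c < k then pos c else 0)) =
        (range (k - 1)).image fun i => a i (pos i) := by
      refine Finset.image_congr fun i hi => ?_
      have : i < k - 1 := by simpa using hi
      simp only [if_pos (show i < k by omega)]
    rw [heq] at h
    rcases hz with rfl | rfl
    · exact h.1
    · exact h.2
  refine ⟨?_, ?_⟩
  · refine List.Nodup.map_on ?_ List.nodup_range
    intro p hp q hq h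
    rw [List.mem_range] at hp hq
    unfold cycleVertex at h
    split_ifs at h with h1 h2 h2
    · omega
    · exact absurd h.symm (hne _ (hcol q) q hq)
    · exact absurd h (hne _ (hcol p) p hp)
    · rcases lt_trichotomy (blockIdx k (s % k) (p / k) (p % k))
        (blockIdx k (s % k) (q / k) (q % k)) with hlt | heq | hlt
      · exact absurd h (hdisj _ _ hlt (hcol q) p hp q hq)
      · rw [heq] at h
        exact hinj _ (hcol q) p hp q hq h
      · exact absurd h.symm (hdisj _ _ hlt (hcol p) q hq p hp)
  · intro p hp
    rw [List.length_map, List.length_range] at hp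
    rw [toFinset_window_map_range (by omega) hp]
    have hwin : ∀ pos : ℕ → ℕ,
        (∀ j < k, pos j < s ∧ (p ≤ pos j ∧ pos j < p + k ∨ pos j + s < p + k)) →
        (∀ j < k, ∀ j' < k, pos j = pos j' → j = j') →
        ((range k).image fun j => cycleVertex k s a z ((p + j) % s)) =
          (range k).image fun i => cycleVertex k s a z (pos i) := by
      intro pos h1 h2
      have := congrArg (Finset.image (cycleVertex k s a z)) (window_eq_image_pos hp pos h1 h2)
      rwa [Finset.image_image, Finset.image_image] at this
    rcases Nat.lt_or_ge (s - k) p with hwrap | hle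
    · -- the window wraps around
      rw [hwin (fun i => if p ≤ s - k + i then s - k + i else i)
        (fun j hj => by split_ifs <;> omega)
        (fun j hj j' hj' h => by split_ifs at h <;> omega)]
      have hmem := image_transversal_mem hk hr ha 0
        (fun i => if p ≤ s - k + i then s - k + i else i) hs0
        (fun j hj => by split_ifs <;> omega)
      convert hmem using 1
      refine Finset.image_congr fun i hi => ?_
      have hi' : i < k := by simpa using hi
      have hk2 : 2 * k ≤ 2 * k * k := Nat.le_mul_of_pos_right _ (by omega)
      simp only [blockIdx_of_le_one (show 1 ≤ k by omega) (Nat.zero_le 1)]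
      split_ifs with h
      · rw [cycleVertex, if_neg (by omega), blockIdx_wrap hk hs hi']
      · rw [cycleVertex, if_neg (by omega), Nat.div_eq_of_lt hi', Nat.mod_eq_of_lt hi',
          blockIdx_of_le_one (by omega) (by omega)]
    · obtain ⟨m, o, ho, rfl⟩ : ∃ m o, o < k ∧ p = k * m + o :=
        ⟨p / k, p % k, Nat.mod_lt _ (by omega), (Nat.div_add_mod p k).symm⟩
      have hkm : k * (m + 1) = k * m + k := by ring
      let pos : ℕ → ℕ := fun i => k * m + (if i < o then k + i else i)
      have hpos : ∀ i < k, pos i < s := fun i hi => by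
        simp only [pos]; split_ifs <;> omega
      rw [hwin pos (fun j hj => by simp only [pos]; split_ifs <;> omega)
        (fun j hj j' hj' h => by simp only [pos] at h; split_ifs at h <;> omega)]
      have hdm : ∀ i < k, pos i / k = (if i < o then m + 1 else m) ∧ pos i % k = i := by
        intro i hi
        simp only [pos]
        split_ifs
        · rw [show k * m + (k + i) = i + k * (m + 1) by omega, Nat.add_mul_div_left _ _ (by omega),
            Nat.add_mul_mod_self_left, Nat.div_eq_of_lt hi, Nat.mod_eq_of_lt hi]
          omega
        · rw [show k * m + i = i + k * m by omega, Nat.add_mul_div_left _ _ (by omega),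
            Nat.add_mul_mod_self_left, Nat.div_eq_of_lt hi, Nat.mod_eq_of_lt hi]
          omega
      rcases Nat.eq_zero_or_pos m with rfl | hm
      · -- the window contains the special vertex
        convert hlink pos hpos using 1
        have hrange : range k = insert (k - 1) (range (k - 1)) := by
          rw [← Finset.range_add_one, Nat.sub_add_cancel (by omega)]
        rw [hrange, Finset.image_insert]
        have hp1 : pos (k - 1) = k - 1 := by simp only [pos]; split_ifs <;> omega
        rw [hp1, cycleVertex, if_pos rfl]
        congr 1
        refine Finset.image_congr fun i hi => ?_
        have hi' : i < k - 1 := by simpa using hi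
        obtain ⟨h1, h2⟩ := hdm i (by omega)
        have hpi : pos i ≠ k - 1 := by simp only [pos]; split_ifs <;> omega
        simp only [cycleVertex, if_neg hpi, h1, h2]
        rw [blockIdx_of_le_one (by omega) (by split_ifs <;> omega)]
      · obtain ⟨w, hw⟩ := exists_forall_ne_blockIdx_succ_eq k (s % k) m
        have hmem := image_transversal_mem hk hr ha (if w < o then m + 1 else m) pos hs0 hpos
        convert hmem using 1
        refine Finset.image_congr fun i hi => ?_
        have hi' : i < k := by simpa using hi
        obtain ⟨h1, h2⟩ := hdm i hi'
        have hkm' : k ≤ k * m := Nat.le_mul_of_pos_right _ hm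
        have hpi : pos i ≠ k - 1 := by simp only [pos]; omega
        simp only [cycleVertex, if_neg hpi, h1, h2]
        congr 1
        have := hw i hi'
        split_ifs <;> first | rfl | exact this (by omega) | exact (this (by omega)).symm

theorem toFinset_map_cycleVertex (hk : 1 ≤ k) (hs : k ≤ s) (z : V) :
    ((List.range s).map (cycleVertex k s a z)).toFinset =
      insert z (((range s).erase (k - 1)).image fun p =>
        a (blockIdx k (s % k) (p / k) (p % k)) p) := by
  have h1 : ((List.range s).map (cycleVertex k s a z)).toFinset =
      (range s).image (cycleVertex k s a z) := by ext; simp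
  rw [h1, ← Finset.insert_erase (Finset.mem_range.mpr (show k - 1 < s by omega)),
    Finset.image_insert, cycleVertex, if_pos rfl]
  congr 1
  rw [Finset.insert_erase (Finset.mem_range.mpr (show k - 1 < s by omega))]
  refine Finset.image_congr fun p hp => ?_
  have : p ≠ k - 1 := by
    simp only [Finset.coe_erase, Set.mem_sdiff, Set.mem_singleton_iff] at hp
    exact hp.2
  simp only [cycleVertex, if_neg this]

end Cycle

/-- for `k ≥ 3`, `s ≥ 5k²` with `k ∤ s`, in every `k`-graph on `n ≥ n₀` vertices
with minimum codegree at least `(1/2 + γ)n`, every pair of distinct vertices `x, y` admits a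
set `S` of `s - 1` further vertices such that both `H[S ∪ {x}]` and `H[S ∪ {y}]` contain a
spanning tight cycle `C_s^k`. -/
theorem closedness_one_copy (k s : ℕ) (hk : 3 ≤ k) (hs : 5 * k ^ 2 ≤ s) (hnd : ¬ k ∣ s)
    (γ : ℝ) (hγ : 0 < γ) :
    ∃ n₀ : ℕ, ∀ (V : Type) [Fintype V] [DecidableEq V] (E : Finset (Finset V)),
      IsKGraph k E → n₀ ≤ Fintype.card V →
      (∀ S : Finset V, S.card = k - 1 →
        (1 / 2 + γ) * (Fintype.card V : ℝ) ≤ (degS E S : ℝ)) →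
      ∀ x y : V, x ≠ y →
        ∃ S : Finset V, S ⊆ Finset.univ \ {x, y} ∧ S.card = s - 1 ∧
          SpansCs k s E (insert x S) ∧ SpansCs k s E (insert y S) := by
  have hr : s % k < k := Nat.mod_lt _ (by omega)
  have hs' : 2 * k * k + 2 * k ≤ s := by nlinarith
  have hs0 : 0 < s := by omega
  obtain ⟨n₁, hn₁⟩ := exists_transversals_subset_of_dense s (2 * k) (γ ^ (2 * k)) (by positivity)
  obtain ⟨n₂, hn₂⟩ := exists_nat_gt ((2 * k + 2 : ℝ) / γ)
  refine ⟨max n₁ (max n₂ k), fun V _ _ E hE hV hdeg x y hxy => ?_⟩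
  have hV1 : n₁ ≤ Fintype.card V := (le_max_left _ _).trans hV
  have hV3 : k ≤ Fintype.card V := ((le_max_right _ _).trans (le_max_right _ _)).trans hV
  have hV2 : (2 * k + 2 : ℝ) ≤ γ * Fintype.card V := by
    have h : (n₂ : ℝ) ≤ Fintype.card V := by
      exact_mod_cast ((le_max_left _ _).trans (le_max_right _ _)).trans hV
    rw [div_lt_iff₀ hγ] at hn₂
    nlinarith
  obtain ⟨R, hR, hRgood⟩ := pow_le_card_of_sequential_choices x (γ * Fintype.card V)
    (by positivity) (IsGoodEntry k (s % k) E x y) (fun j g g' h => IsGoodEntry.congr hr h) (2 * k)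
    (fun j hj g hg => exists_good_entries hk hr hE hV2 hV3 hdeg hj g hg)
  rw [mul_pow] at hR
  obtain ⟨A, hAinj, hAR⟩ := hn₁ V R hV1 hR
  let a : ℕ → ℕ → V := fun c p =>
    if h : c < 2 * k ∧ p < s then A ⟨c, h.1⟩ ⟨p, h.2⟩ else x
  have hinj : ∀ c < 2 * k, ∀ p < s, ∀ q < s, a c p = a c q → p = q := by
    intro c hc p hp q hq h
    simp only [a, dif_pos (And.intro hc hp), dif_pos (And.intro hc hq)] at h
    exact congrArg Fin.val (hAinj _ h)
  have ha : ∀ φ : ℕ → ℕ, (∀ c, φ c < s) → ∀ j < 2 * k,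
      IsGoodEntry k (s % k) E x y j fun c => a c (φ c) := by
    intro φ hφ
    refine hRgood _ (hAR fun i => ⟨φ i, hφ i⟩) _ fun i => ?_
    simp only [a, dif_pos (And.intro i.2 (hφ i))]
  have hspan : ∀ z, z = x ∨ z = y → SpansCs k s E (insert z (((range s).erase (k - 1)).image
      fun p => a (blockIdx k (s % k) (p / k) (p % k)) p)) := fun z hz =>
    ⟨_, by simp, isTightCycleList_cycleVertex hk hs' hinj ha hz,
      toFinset_map_cycleVertex (by omega) (by omega) z⟩
  have hmem : ∀ z, z = x ∨ z = y → z ∉ ((range s).erase (k - 1)).image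
      fun p => a (blockIdx k (s % k) (p / k) (p % k)) p := by
    intro z hz hmem
    obtain ⟨p, hp, h⟩ := Finset.mem_image.mp hmem
    have hp' := Finset.mem_range.mp (Finset.mem_of_mem_erase hp)
    have hgood := ha (fun _ => p) (fun _ => hp') (blockIdx k (s % k) (p / k) (p % k))
      (blockIdx_lt hr (Nat.mod_lt _ (by omega)))
    rcases hz with rfl | rfl
    · exact hgood.1 h
    · exact hgood.2.1 h
  refine ⟨_, ?_, ?_, hspan x (Or.inl rfl), hspan y (Or.inr rfl)⟩
  · intro v hv
    simp only [Finset.mem_sdiff, Finset.mem_univ, Finset.mem_insert, Finset.mem_singleton,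
      true_and]
    intro h
    exact hmem v h hv
  · obtain ⟨C, hC, hCyc, hCS⟩ := hspan x (Or.inl rfl)
    have h := congrArg Finset.card hCS
    rw [List.toFinset_card_of_nodup hCyc.1, hC, Finset.card_insert_of_notMem
      (hmem x (Or.inl rfl))] at h
    omega
end
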